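/- arXiv:0907.0141 — 2 statements merged into one kernel-verified Lean document; each statement's English description precedes it below -/
import Mathlib

section
/- Let ℓ ≥ 0 and k ≥ 1 be integers and p_1, …, p_k (not necessarily distinct) primes. Then for every non-negative function ψ : ℕ → ℝ, the measure μ(W_{ℓ,p_1,…,p_k}(ψ)) is equal to 0 or 1. -/
open MeasureTheory Filter
open scoped ENNReal

noncomputable section

/-- The set `E_n^{ℓ,p_1,…,p_k}(ψ) ⊆ (ℝ/ℤ)^ℓ × ℤ_{p_1} × ⋯ × ℤ_{p_k}`: points all of
whose coordinates admit a rational approximation `a/n` with `|a| ≤ n`, `gcd(a,n) = 1`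
within distance `ψ(n)` (quotient distance on the circle coordinates, `p_i`-adic
distance on the `p_i`-adic coordinates). -/
def prodE (ℓ k : ℕ) (P : Fin k → ℕ) [∀ i, Fact (P i).Prime] (ψ : ℕ → ℝ) (n : ℕ) :
    Set ((Fin ℓ → UnitAddCircle) × ((i : Fin k) → ℤ_[P i])) :=
  {x | (∀ i : Fin ℓ, ∃ a : ℤ, |a| ≤ (n : ℤ) ∧ Int.gcd a n = 1 ∧
          ‖x.1 i - (((a : ℝ) / (n : ℝ) : ℝ) : UnitAddCircle)‖ ≤ ψ n) ∧
       (∀ i : Fin k, ∃ a : ℤ, |a| ≤ (n : ℤ) ∧ Int.gcd a n = 1 ∧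
          ‖(x.2 i : ℚ_[P i]) - (a : ℚ_[P i]) / (n : ℚ_[P i])‖ ≤ ψ n)}

/-- `W_{ℓ,p_1,…,p_k}(ψ)`: points lying in infinitely many of the sets
`E_n^{ℓ,p_1,…,p_k}(ψ)`. -/
def prodW (ℓ k : ℕ) (P : Fin k → ℕ) [∀ i, Fact (P i).Prime] (ψ : ℕ → ℝ) :
    Set ((Fin ℓ → UnitAddCircle) × ((i : Fin k) → ℤ_[P i])) :=
  {x | {n : ℕ | x ∈ prodE ℓ k P ψ n}.Infinite}

/-- The product measure on `(ℝ/ℤ)^ℓ × ℤ_{p_1} × ⋯ × ℤ_{p_k}` built from Lebesgue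
measure on the circle factors and given measures on the `p_i`-adic factors. -/
def prodMeasure (ℓ k : ℕ) (P : Fin k → ℕ) [∀ i, Fact (P i).Prime]
    [∀ i, MeasurableSpace ℤ_[P i]] (μs : (i : Fin k) → Measure ℤ_[P i]) :
    Measure ((Fin ℓ → UnitAddCircle) × ((i : Fin k) → ℤ_[P i])) :=
  (Measure.pi fun _ : Fin ℓ => (volume : Measure UnitAddCircle)).prod (Measure.pi μs)

/-- If `n` divides `D * D'`, every block of `D + D'` consecutive integers contains one coprime
to `n`. -/
theorem exists_coprime_of_dvd_mul {n D D' : ℕ} (hn : n ∣ D * D') (hD : 0 < D) (hD' : 0 < D')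
    (u : ℤ) : ∃ a : ℤ, u ≤ a ∧ a ≤ u + D + D' ∧ Int.gcd a n = 1 := by
  classical
  obtain ⟨v, hv₁, hv₂, hv⟩ : ∃ v : ℤ, u ≤ v ∧ v < u + D ∧ (D : ℤ) ∣ v := by
    refine ⟨u + (-u) % D, ?_, ?_, ?_⟩
    · have := Int.emod_nonneg (-u) (b := D) (by positivity); omega
    · have := Int.emod_lt_of_pos (-u) (b := D) (by positivity); omega
    · have := Int.emod_add_mul_ediv (-u) D
      exact ⟨-((-u) / D), by linarith⟩
  set s : ℕ := ∏ q ∈ D'.primeFactors.filter fun q : ℕ => ¬ (q : ℤ) ∣ v, q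
  have hs : s ≤ D' := Nat.le_of_dvd hD' <|
    (Finset.prod_dvd_prod_of_subset _ _ _ (Finset.filter_subset _ _)).trans
      (Nat.prod_primeFactors_dvd D')
  refine ⟨v + s, by omega, by omega, ?_⟩
  by_contra hgcd
  obtain ⟨q, hq, hqg⟩ := Nat.exists_prime_and_dvd hgcd
  have hqa : (q : ℤ) ∣ v + s := (Int.natCast_dvd_natCast.2 hqg).trans (Int.gcd_dvd_left _ _)
  have hqn : q ∣ n := Int.natCast_dvd_natCast.1
    ((Int.natCast_dvd_natCast.2 hqg).trans (Int.gcd_dvd_right _ _))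
  by_cases hqv : (q : ℤ) ∣ v
  · have hqs : q ∣ s := by
      have := (Int.dvd_add_right hqv).1 hqa
      exact_mod_cast this
    obtain ⟨t, ht, hqt⟩ := (hq.prime.dvd_finsetProd_iff _).1 hqs
    rw [Finset.mem_filter] at ht
    rw [(Nat.prime_dvd_prime_iff_eq hq (Nat.prime_of_mem_primeFactors ht.1)).1 hqt] at hqv
    exact ht.2 hqv
  · have hqs : (q : ℤ) ∣ s := by
      have hqD : q ∣ D' := ((Nat.Prime.dvd_mul hq).1 (hqn.trans hn)).resolve_left fun h =>
        hqv ((Int.natCast_dvd_natCast.2 h).trans hv)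
      exact_mod_cast Finset.dvd_prod_of_mem (fun q : ℕ => q)
        (Finset.mem_filter.2 ⟨Nat.mem_primeFactors.2 ⟨hq, hqD, hD'.ne'⟩, hqv⟩)
    exact hqv ((Int.dvd_add_left hqs).1 hqa)

/-- If `q` is a prime larger than `e`, every block of `2 * e` consecutive integers contains one
coprime to `q * e`. -/
theorem exists_coprime_prime_mul {q e : ℕ} (hq : q.Prime) (he : 0 < e) (heq : e < q) (u : ℤ) :
    ∃ a : ℤ, u ≤ a ∧ a ≤ u + 2 * e ∧ Int.gcd a (q * e : ℕ) = 1 := by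
  obtain ⟨v, hv₁, hv₂, k, hv⟩ : ∃ v : ℤ, u ≤ v ∧ v < u + e ∧ ∃ k : ℤ, v = 1 + k * e := by
    refine ⟨u + (1 - u) % e, ?_, ?_, ?_⟩
    · have := Int.emod_nonneg (1 - u) (b := e) (by positivity); omega
    · have := Int.emod_lt_of_pos (1 - u) (b := e) (by positivity); omega
    · have := Int.emod_add_mul_ediv (1 - u) e
      exact ⟨-((1 - u) / e), by linarith⟩
  have key : ∀ j : ℤ, ¬ (q : ℤ) ∣ 1 + j * e → Int.gcd (1 + j * e) (q * e : ℕ) = 1 := by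
    intro j hj
    rw [← Int.isCoprime_iff_gcd_eq_one, Nat.cast_mul]
    refine IsCoprime.mul_right ?_ ⟨1, -j, by ring⟩
    exact ((Nat.prime_iff_prime_int.1 hq).coprime_iff_not_dvd.2 hj).symm
  by_cases h : (q : ℤ) ∣ 1 + k * e
  · refine ⟨1 + (k + 1) * e, by linarith, by linarith, key _ fun h' => ?_⟩
    have : (q : ℤ) ∣ e := by
      have := dvd_sub h' h
      ring_nf at this
      exact this
    exact absurd (Nat.le_of_dvd he (Int.natCast_dvd_natCast.1 this)) (by omega)
  · exact ⟨1 + k * e, by linarith, by linarith, key _ h⟩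

/-- The gaps between consecutive integers coprime to `n` are `o(n)`. -/
theorem exists_coprime_mem_Icc_of_large {c : ℝ} (hc : 0 < c) :
    ∀ᶠ n : ℕ in atTop, ∀ u : ℝ, ∃ a : ℤ, u ≤ a ∧ (a : ℝ) ≤ u + c * n ∧ Int.gcd a n = 1 := by
  obtain ⟨K, hK⟩ := exists_nat_gt (3 / c)
  have hK0 : (0 : ℝ) < K := lt_trans (by positivity) hK
  have hcK : 3 < c * K := by rwa [div_lt_iff₀' hc] at hK
  filter_upwards [eventually_ge_atTop (K ^ 4)] with n hn u
  have hK1 : 0 < K := by exact_mod_cast hK0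
  have hn0 : 0 < n := lt_of_lt_of_le (by positivity) hn
  suffices h : ∃ a : ℤ, ⌈u⌉ ≤ a ∧ ((a - ⌈u⌉ : ℤ) : ℝ) * K ≤ 2 * n ∧ Int.gcd a n = 1 by
    obtain ⟨a, h₁, h₂, h₃⟩ := h
    refine ⟨a, Int.ceil_le.1 h₁, ?_, h₃⟩
    have hu := Int.ceil_lt_add_one u
    push_cast at h₂
    have hKn : (K : ℝ) ≤ n := by
      exact_mod_cast (Nat.le_self_pow (by norm_num) K).trans hn
    have : ((a : ℝ) - u) * K ≤ c * n * K := by nlinarith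
    have := le_of_mul_le_mul_right this hK0
    linarith
  classical
  have hex : ∃ D, K ≤ D ∧ D ∣ n :=
    ⟨n, (Nat.le_self_pow (by norm_num) K).trans hn, dvd_rfl⟩
  obtain ⟨⟨hDK, hDn⟩, hmin⟩ := (⟨Nat.find_spec hex, fun m => Nat.find_min hex⟩ :
    (K ≤ Nat.find hex ∧ Nat.find hex ∣ n) ∧ ∀ m, m < Nat.find hex → ¬ (K ≤ m ∧ m ∣ n))
  generalize Nat.find hex = D at hDK hDn hmin
  obtain ⟨D', rfl⟩ := hDn
  have hD0 : 0 < D := hK1.trans_le hDK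
  have hD'0 : 0 < D' := Nat.pos_of_mul_pos_left hn0
  by_cases hD' : K ≤ D'
  · obtain ⟨a, h₁, h₂, h₃⟩ := exists_coprime_of_dvd_mul (dvd_refl (D * D')) hD0 hD'0 ⌈u⌉
    refine ⟨a, h₁, ?_, h₃⟩
    have hle : ((a - ⌈u⌉ : ℤ) : ℝ) ≤ D + D' := by
      have : a - ⌈u⌉ ≤ (D + D' : ℤ) := by linarith
      exact_mod_cast this
    have e₁ : (K : ℝ) ≤ D := by exact_mod_cast hDK
    have e₂ : (K : ℝ) ≤ D' := by exact_mod_cast hD'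
    push_cast at hle ⊢
    nlinarith
  · push Not at hD'
    rcases Nat.lt_or_ge 1 K with hK2 | hK2
    swap
    · have : D' = 0 := by omega
      omega
    obtain ⟨q, hq, e, rfl⟩ := Nat.exists_prime_and_dvd (n := D) (by omega)
    have he0 : 0 < e := Nat.pos_of_mul_pos_left hD0
    have heK : e < K := by
      by_contra h
      refine hmin e ?_ ⟨not_lt.1 h, (Dvd.intro_left q rfl).mul_right D'⟩
      exact (Nat.lt_mul_iff_one_lt_left he0).2 hq.one_lt
    have heD : e * D' < K ^ 2 := by nlinarith
    have hlt : e * D' < q := by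
      by_contra h
      have : q * e * D' < K ^ 2 * K ^ 2 := by
        calc q * e * D' = q * (e * D') := by ring
          _ < _ := by nlinarith
      nlinarith
    obtain ⟨a, h₁, h₂, h₃⟩ := exists_coprime_prime_mul hq (Nat.mul_pos he0 hD'0) hlt ⌈u⌉
    refine ⟨a, h₁, ?_, by rwa [mul_assoc]⟩
    have hle : a - ⌈u⌉ ≤ 2 * (K ^ 2 : ℕ) := by
      have : ((e * D' : ℕ) : ℤ) ≤ (K ^ 2 : ℕ) := by exact_mod_cast heD.le
      linarith
    have hle' : ((a - ⌈u⌉ : ℤ) : ℝ) ≤ 2 * (K : ℝ) ^ 2 := by exact_mod_cast hle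
    have hn' : (K : ℝ) ^ 4 ≤ ((q * e * D' : ℕ) : ℝ) := by exact_mod_cast hn
    have hK1' : (1 : ℝ) ≤ K := by exact_mod_cast hK1
    calc ((a - ⌈u⌉ : ℤ) : ℝ) * K ≤ 2 * (K : ℝ) ^ 2 * K := by gcongr
      _ = 2 * (K : ℝ) ^ 3 := by ring
      _ ≤ 2 * (K : ℝ) ^ 4 := by
        gcongr
        norm_num
      _ ≤ _ := by gcongr

/-- A sequence of measurable sets satisfies the zero-one law if the limsup along every set of
indices is null or conull. -/
def LimsupZeroOne {X : Type*} [MeasurableSpace X] (μ : Measure X) (F : ℕ → Set X) : Prop :=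
  (∀ n, MeasurableSet (F n)) ∧ ∀ N : Set ℕ,
    (∀ᵐ x ∂μ, ¬ ∃ᶠ n in atTop, n ∈ N ∧ x ∈ F n) ∨ ∀ᵐ x ∂μ, ∃ᶠ n in atTop, n ∈ N ∧ x ∈ F n

theorem measurableSet_frequently {X : Type*} [MeasurableSpace X] {F : ℕ → Set X}
    (hF : ∀ n, MeasurableSet (F n)) (N : Set ℕ) :
    MeasurableSet {x | ∃ᶠ n in atTop, n ∈ N ∧ x ∈ F n} := by
  simp only [frequently_atTop]
  refine measurableSet_setOfPred.2 (Measurable.forall fun m => Measurable.exists fun n => ?_)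
  exact measurable_const.and (measurable_const.and (measurableSet_setOfPred.1 (hF n)))

theorem LimsupZeroOne.prod {X Y : Type*} [MeasurableSpace X] [MeasurableSpace Y]
    {μ : Measure X} {ν : Measure Y} [IsProbabilityMeasure μ] [IsProbabilityMeasure ν]
    {F : ℕ → Set X} {G : ℕ → Set Y} (hF : LimsupZeroOne μ F) (hG : LimsupZeroOne ν G) :
    LimsupZeroOne (μ.prod ν) fun n => {z | z.1 ∈ F n ∧ z.2 ∈ G n} := by
  have hm : ∀ n, MeasurableSet {z : X × Y | z.1 ∈ F n ∧ z.2 ∈ G n} := fun n =>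
    (hF.1 n).prod (hG.1 n)
  refine ⟨hm, fun N => ?_⟩
  set L : Set (X × Y) := {z | ∃ᶠ n in atTop, n ∈ N ∧ z.1 ∈ F n ∧ z.2 ∈ G n} with hL
  have hLm : MeasurableSet L := measurableSet_frequently hm N
  have h₁ : ∀ x, (∀ᵐ y ∂ν, (x, y) ∉ L) ∨ ∀ᵐ y ∂ν, (x, y) ∈ L := fun x => by
    simpa [hL, and_assoc] using hG.2 {n | n ∈ N ∧ x ∈ F n}
  have h₂ : ∀ y, (∀ᵐ x ∂μ, (x, y) ∉ L) ∨ ∀ᵐ x ∂μ, (x, y) ∈ L := fun y => by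
    simpa [hL, and_assoc, and_comm, and_left_comm] using hF.2 {n | n ∈ N ∧ y ∈ G n}
  set B : Set X := {x | ν (Prod.mk x ⁻¹' Lᶜ) = 0} with hB
  have hBm : MeasurableSet B :=
    measurable_measure_prodMk_left hLm.compl (measurableSet_singleton 0)
  have hxB : ∀ x, x ∈ B ↔ ∀ᵐ y ∂ν, (x, y) ∈ L := fun x => Iff.rfl
  have hLB : ∀ᵐ z ∂μ.prod ν, z ∈ L ↔ z.1 ∈ B := by
    refine (Measure.ae_prod_iff_ae_ae ?_).2 (ae_of_all _ fun x => ?_)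
    · exact measurableSet_setOfPred.2 <| (measurableSet_setOfPred.1 hLm).iff
        (measurableSet_setOfPred.1 (measurable_fst hBm))
    · by_cases hx : x ∈ B
      · filter_upwards [(hxB x).1 hx] with y hy
        simp [hx, hy]
      · filter_upwards [(h₁ x).resolve_right fun h => hx ((hxB x).2 h)] with y hy
        simp [hx, hy]
  have hLB' : ∀ᵐ z ∂ν.prod μ, (z.2, z.1) ∈ L ↔ z.2 ∈ B :=
    Measure.measurePreserving_swap.quasiMeasurePreserving.ae hLB
  obtain ⟨y, hy⟩ := (Measure.ae_ae_of_ae_prod hLB').exists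
  have hfst : Measure.QuasiMeasurePreserving Prod.fst (μ.prod ν) μ :=
    Measure.quasiMeasurePreserving_fst
  rcases h₂ y with h | h
  · left
    have hx : ∀ᵐ x ∂μ, x ∉ B := by
      filter_upwards [hy, h] with x h1 h2
      exact fun h3 => h2 (h1.2 h3)
    filter_upwards [hLB, hfst.ae hx] with z h1 h2
    exact fun h3 => h2 (h1.1 h3)
  · right
    have hx : ∀ᵐ x ∂μ, x ∈ B := by
      filter_upwards [hy, h] with x h1 h2
      exact h1.1 h2
    filter_upwards [hLB, hfst.ae hx] with z h1 h2
    exact h1.2 h2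

theorem LimsupZeroOne.comp_measurePreserving {X Y : Type*} [MeasurableSpace X]
    [MeasurableSpace Y] {μ : Measure X} {ν : Measure Y} {F : ℕ → Set Y}
    (hF : LimsupZeroOne ν F) {f : X → Y} (hf : MeasurePreserving f μ ν) :
    LimsupZeroOne μ fun n => f ⁻¹' F n :=
  ⟨fun n => hf.measurable (hF.1 n), fun N =>
    (hF.2 N).imp hf.quasiMeasurePreserving.ae hf.quasiMeasurePreserving.ae⟩

theorem LimsupZeroOne.pi {m : ℕ} {X : Fin m → Type*} [∀ i, MeasurableSpace (X i)]
    {μ : ∀ i, Measure (X i)} [∀ i, IsProbabilityMeasure (μ i)] {F : ∀ i, ℕ → Set (X i)}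
    (hF : ∀ i, LimsupZeroOne (μ i) (F i)) :
    LimsupZeroOne (Measure.pi μ) fun n => {x | ∀ i, x i ∈ F i n} := by
  induction m with
  | zero =>
    refine ⟨fun n => by simp, fun N => ?_⟩
    simp only [IsEmpty.forall_iff, Set.mem_ofPred_eq, and_true]
    by_cases h : ∃ᶠ n in atTop, n ∈ N <;> simp [h]
  | succ m ih =>
    have := ((hF 0).prod (ih fun i => hF i.succ)).comp_measurePreserving
      (measurePreserving_piFinSuccAbove μ 0)
    convert! this using 2 with n
    ext x
    simp only [Set.mem_ofPred_eq, Fin.forall_fin_succ]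
    exact Iff.rfl

theorem mem_blimsup_atTop_iff {X : Type*} {s : ℕ → Set X} {q : ℕ → Prop} {x : X} :
    x ∈ (blimsup s atTop q : Set X) ↔ ∃ᶠ n in atTop, q n ∧ x ∈ s n := by
  rw [← Nat.cofinite_eq_atTop, cofinite.blimsup_set_eq, frequently_cofinite_iff_infinite]
  exact Iff.rfl

theorem exists_frequently_le_of_not_tendsto_zero {r : ℕ → ℝ} (hr : ∀ n, 0 ≤ r n)
    (h : ¬ Tendsto r atTop (nhds 0)) : ∃ c > 0, ∃ᶠ n in atTop, c ≤ r n := by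
  contrapose! h
  refine Metric.tendsto_nhds.2 fun c hc => ?_
  filter_upwards [h c hc] with n hn
  rwa [Real.dist_0_eq_abs, abs_of_nonneg (hr n)]

/-- Points of the circle within `δ` of a fraction `a / n` in lowest terms with `|a| ≤ n`. -/
def circleApprox (n : ℕ) (δ : ℝ) : Set UnitAddCircle :=
  {x | ∃ a : ℤ, |a| ≤ (n : ℤ) ∧ Int.gcd a n = 1 ∧ ‖x - (((a : ℝ) / (n : ℝ) : ℝ) : UnitAddCircle)‖ ≤ δ}

theorem measurableSet_circleApprox (n : ℕ) (δ : ℝ) : MeasurableSet (circleApprox n δ) := by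
  refine measurableSet_setOfPred.2 (Measurable.exists fun a => ?_)
  refine measurable_const.and (measurable_const.and (measurableSet_setOfPred.1 ?_))
  exact (isClosed_le (by fun_prop) continuous_const).measurableSet

theorem eventually_circleApprox_eq_univ {c : ℝ} (hc : 0 < c) :
    ∀ᶠ n : ℕ in atTop, ∀ x, x ∈ circleApprox n c := by
  have hc' : 0 < min c 1 := lt_min hc one_pos
  filter_upwards [exists_coprime_mem_Icc_of_large hc', eventually_gt_atTop 0] with n hn hn0 x
  have hn0' : (0 : ℝ) < n := by exact_mod_cast hn0
  obtain ⟨y, rfl⟩ := QuotientAddGroup.mk_surjective x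
  obtain ⟨a, h₁, h₂, h₃⟩ := hn (Int.fract y * n - min c 1 * n)
  have hf0 := mul_nonneg (Int.fract_nonneg y) hn0'.le
  have hf1 : Int.fract y * n < n := mul_lt_of_lt_one_left hn0' (Int.fract_lt_one y)
  have hm : min c 1 * n ≤ n := mul_le_of_le_one_left hn0'.le (min_le_right _ _)
  refine ⟨a, ?_, h₃, ?_⟩
  · rw [abs_le]
    have e₁ : (-(n : ℤ) : ℝ) ≤ a := by push_cast; linarith
    have e₂ : (a : ℝ) ≤ (n : ℤ) := by push_cast; linarith
    exact ⟨by exact_mod_cast e₁, by exact_mod_cast e₂⟩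
  · have hy : ((y : ℝ) : UnitAddCircle) = ((Int.fract y : ℝ) : UnitAddCircle) := by
      conv_lhs => rw [← Int.fract_add_floor y]
      rw [AddCircle.coe_add]
      simp
    change ‖((y : ℝ) : UnitAddCircle) - _‖ ≤ c
    rw [hy, ← AddCircle.coe_sub]
    refine (QuotientAddGroup.norm_mk_le_norm).trans ?_
    have h4 : |Int.fract y - a / n| * n ≤ min c 1 * n := by
      rw [← abs_of_pos hn0', ← abs_mul, abs_of_pos hn0', sub_mul, div_mul_cancel₀ _ hn0'.ne',
        abs_le]
      constructor <;> linarith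
    exact (le_of_mul_le_mul_right h4 hn0').trans (min_le_left _ _)

theorem circleApprox_subset_cthickening {n : ℕ} (hn : 0 < n) (δ : ℝ) :
    circleApprox n δ ⊆ Metric.cthickening δ {y | addOrderOf y = n} := by
  rintro x ⟨a, -, ha, hx⟩
  refine Metric.mem_cthickening_of_dist_le _ _ _ _ ?_ (by rwa [dist_eq_norm])
  have := AddCircle.addOrderOf_div_of_gcd_eq_one' (p := (1 : ℝ)) hn (m := a) ha
  rwa [mul_one] at this

theorem approxAddOrderOf_subset_circleApprox {n : ℕ} (hn : 0 < n) (δ : ℝ) :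
    approxAddOrderOf UnitAddCircle n δ ⊆ circleApprox n δ := by
  intro x hx
  obtain ⟨m, hm, hg, hx⟩ := (UnitAddCircle.mem_approxAddOrderOf_iff hn).1 hx
  exact ⟨m, by simpa using hm.le, (Int.gcd_natCast_natCast m n).trans hg, by simpa using hx.le⟩

theorem countable_circleApprox_zero (n : ℕ) : (circleApprox n 0).Countable := by
  refine (Set.countable_range
    fun a : ℤ => (((a : ℝ) / (n : ℝ) : ℝ) : UnitAddCircle)).mono ?_
  rintro x ⟨a, -, -, hx⟩
  exact ⟨a, (sub_eq_zero.1 (norm_le_zero_iff.1 hx)).symm⟩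

theorem nullSingletonClass_unitAddCircle :
    NullSingletonClass (volume : Measure UnitAddCircle) := by
  refine ⟨fun x => ?_⟩
  rw [← Metric.closedBall_zero, AddCircle.volume_closedBall]
  simp

theorem limsupZeroOne_circleApprox {ψ : ℕ → ℝ} (hψ : ∀ n, 0 ≤ ψ n) :
    LimsupZeroOne volume fun n => circleApprox n (ψ n) := by
  classical
  refine ⟨fun n => measurableSet_circleApprox n _, fun N => ?_⟩
  set r : ℕ → ℝ := fun n => if n ∈ N then ψ n else 0 with hr
  have hr0 : ∀ n, 0 ≤ r n := fun n => by simp only [hr]; split_ifs <;> simp [hψ]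
  have hrN : ∀ n, 0 < r n → n ∈ N := fun n h => by
    by_contra hn
    simp [hr, hn] at h
  have hrψ : ∀ n ∈ N, r n = ψ n := fun n hn => by simp [hr, hn]
  by_cases ht : Tendsto r atTop (nhds 0)
  · have hcth := blimsup_cthickening_ae_eq_blimsup_thickening (volume : Measure UnitAddCircle)
      (p := fun n => 0 < n ∧ 0 < r n) (s := fun n => {y | addOrderOf y = n}) ht
      (Eventually.of_forall fun n hn => hn.2)
    have hsub : ∀ x ∈ addWellApproximable UnitAddCircle r,
        ∃ᶠ n in atTop, n ∈ N ∧ x ∈ circleApprox n (ψ n) := by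
      intro x hx
      refine (mem_blimsup_atTop_iff.1 hx).mono fun n hn => ?_
      have hn' : 0 < r n := by
        obtain ⟨m, -, -, h⟩ := (UnitAddCircle.mem_approxAddOrderOf_iff hn.1).1 hn.2
        exact (norm_nonneg _).trans_lt h
      refine ⟨hrN n hn', ?_⟩
      rw [← hrψ n (hrN n hn')]
      exact approxAddOrderOf_subset_circleApprox hn.1 _ hn.2
    refine (AddCircle.addWellApproximable_ae_empty_or_univ r ht).imp (fun h => ?_) fun h =>
      h.mono hsub
    have := nullSingletonClass_unitAddCircle
    have hZ : ∀ᵐ x : UnitAddCircle, ∀ n, x ∉ circleApprox n 0 :=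
      ae_all_iff.2 fun n => (countable_circleApprox_zero n).ae_notMem _
    filter_upwards [h, hZ, hcth.mem_iff] with x hx hxZ hxc hW
    have hxc' := hxc.1 <| mem_blimsup_atTop_iff.2 <|
      (hW.and_eventually (eventually_gt_atTop 0)).mono fun n hn => by
        have hpos : 0 < r n := by
          refine (hr0 n).lt_of_ne fun h0 => hxZ n ?_
          rw [h0, hrψ n hn.1.1]
          exact hn.1.2
        refine ⟨⟨hn.2, hpos⟩, circleApprox_subset_cthickening hn.2 _ ?_⟩
        rw [hrψ n hn.1.1]
        exact hn.1.2
    exact hx (mem_blimsup_atTop_iff.2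
      ((mem_blimsup_atTop_iff.1 hxc').mono fun n hn => ⟨hn.1.1, hn.2⟩))
  · obtain ⟨c, hc, hfr⟩ := exists_frequently_le_of_not_tendsto_zero hr0 ht
    refine Or.inr (ae_of_all _ fun x => ?_)
    refine (hfr.and_eventually (eventually_circleApprox_eq_univ hc)).mono fun n hn => ?_
    have hnN := hrN n (hc.trans_le hn.1)
    obtain ⟨a, h₁, h₂, h₃⟩ := hn.2 x
    exact ⟨hnN, a, h₁, h₂, h₃.trans (hn.1.trans (hrψ n hnN).le)⟩

section Padic

variable {p : ℕ} [Fact p.Prime]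

/-- The `p`-adic integers `x` such that `n * x` is within `ρ` of an integer `a` coprime to `n`
with `α * n ≤ a ≤ β * n`. -/
def padicApprox (p : ℕ) [Fact p.Prime] (n : ℕ) (ρ α β : ℝ) : Set ℤ_[p] :=
  {x | ∃ a : ℤ, α * n ≤ a ∧ (a : ℝ) ≤ β * n ∧ Int.gcd a n = 1 ∧ ‖(n : ℤ_[p]) * x - a‖ ≤ ρ}

/-- The `p`-adic integers lying in `padicApprox p n (r n) α β` for infinitely many `n ∈ N`. -/
def padicLimsup (p : ℕ) [Fact p.Prime] (N : Set ℕ) (r : ℕ → ℝ) (α β : ℝ) : Set ℤ_[p] :=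
  {x | ∃ᶠ n in atTop, n ∈ N ∧ x ∈ padicApprox p n (r n) α β}

theorem padicLimsup_mono {N : Set ℕ} {r : ℕ → ℝ} {α β α' β' : ℝ} (hα : α' ≤ α) (hβ : β ≤ β') :
    padicLimsup p N r α β ⊆ padicLimsup p N r α' β' := by
  refine fun x hx => Frequently.mono hx fun n hn => ⟨hn.1, ?_⟩
  obtain ⟨a, h₁, h₂, h⟩ := hn.2
  exact ⟨a, le_trans (by gcongr) h₁, h₂.trans (by gcongr), h⟩

theorem add_intCast_mem_padicLimsup {N : Set ℕ} {r : ℕ → ℝ} {α β : ℝ} {x : ℤ_[p]}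
    (hx : x ∈ padicLimsup p N r α β) (m : ℤ) :
    m + x ∈ padicLimsup p N r (α + m) (β + m) := by
  refine Frequently.mono hx fun n hn => ⟨hn.1, ?_⟩
  obtain ⟨a, h₁, h₂, h₃, h₄⟩ := hn.2
  refine ⟨a + m * n, by push_cast; linarith, by push_cast; linarith, by simpa using h₃, ?_⟩
  convert h₄ using 2
  push_cast
  ring

theorem add_intCast_mem_padicLimsup_iff {N : Set ℕ} {r : ℕ → ℝ} {α β : ℝ} {x : ℤ_[p]} (m : ℤ) :
    m + x ∈ padicLimsup p N r (α + m) (β + m) ↔ x ∈ padicLimsup p N r α β := by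
  refine ⟨fun h => ?_, fun h => add_intCast_mem_padicLimsup h m⟩
  simpa using add_intCast_mem_padicLimsup h (-m)

/-- The self-similarity of `padicLimsup` under the contractions `x ↦ b + p * x`. -/
theorem mem_padicLimsup_of_add_p_mul_mem {N : Set ℕ} {r : ℕ → ℝ} (hr : Tendsto r atTop (nhds 0))
    {α β : ℝ} {x : ℤ_[p]} (b : ℕ) (hx : b + p * x ∈ padicLimsup p N r α β) :
    x ∈ padicLimsup p N (fun n => p * r n) ((α - b) / p) ((β - b) / p) := by
  have hp : (0 : ℝ) < p := by exact_mod_cast (Fact.out : p.Prime).pos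
  refine (Frequently.and_eventually hx (hr.eventually_lt_const one_pos)).mono ?_
  rintro n ⟨⟨hnN, a, h₁, h₂, h₃, h₄⟩, hrn⟩
  have hdvd : (p : ℤ) ∣ a - n * b := by
    rw [← PadicInt.norm_intCast_lt_one_iff (p := p), PadicInt.norm_lt_one_iff_dvd]
    obtain ⟨y, hy⟩ := (PadicInt.norm_lt_one_iff_dvd _).1 (h₄.trans_lt hrn)
    refine ⟨n * x - y, ?_⟩
    push_cast
    linear_combination -hy
  obtain ⟨a', ha'⟩ := hdvd
  obtain rfl : a = p * a' + n * b := by linarith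
  push_cast at h₁ h₂
  refine ⟨hnN, a', ?_, ?_, ?_, ?_⟩
  · rw [div_mul_eq_mul_div, div_le_iff₀ hp]; linarith
  · rw [div_mul_eq_mul_div, le_div_iff₀ hp]; linarith
  · rw [← Int.isCoprime_iff_gcd_eq_one] at h₃ ⊢
    exact (IsCoprime.of_add_mul_left_left h₃).of_mul_left_right
  · have : (n : ℤ_[p]) * (b + p * x) - ((p * a' + n * b : ℤ) : ℤ_[p]) = p * (n * x - a') := by
      push_cast; ring
    rw [this, norm_mul, PadicInt.norm_p, inv_mul_le_iff₀ hp] at h₄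
    exact h₄

theorem padicApprox_eq_cthickening {n : ℕ} (hn : ¬ p ∣ n) {ρ : ℝ} (hρ : 0 ≤ ρ) (α β : ℝ) :
    padicApprox p n ρ α β = Metric.cthickening ρ ((fun y : ℤ_[p] => n * y) ⁻¹'
      ((fun a : ℤ => (a : ℤ_[p])) '' {a | α * n ≤ a ∧ (a : ℝ) ≤ β * n ∧ Int.gcd a n = 1})) := by
  have hn0 : (n : ℤ_[p]) ≠ 0 := by
    rintro h
    exact hn (by rw [Nat.cast_eq_zero.1 h]; exact dvd_zero p)
  have hn1 : ‖(n : ℤ_[p])‖ = 1 := by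
    rw [PadicInt.norm_natCast_eq_one_iff]
    exact (Nat.Prime.coprime_iff_not_dvd Fact.out).2 hn
  have hfin : {a : ℤ | α * n ≤ a ∧ (a : ℝ) ≤ β * n ∧ Int.gcd a n = 1}.Finite :=
    (Set.finite_Icc ⌈α * n⌉ ⌊β * n⌋).subset fun a ha => ⟨Int.ceil_le.2 ha.1, Int.le_floor.2 ha.2.1⟩
  rw [((hfin.image _).preimage (mul_right_injective₀ hn0).injOn).isCompact.cthickening_eq_biUnion_closedBall
    hρ]
  ext x
  simp only [padicApprox, Set.mem_ofPred_eq, Set.mem_iUnion, Set.mem_preimage, Set.mem_image,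
    Metric.mem_closedBall, dist_eq_norm]
  constructor
  · rintro ⟨a, h₁, h₂, h₃, h₄⟩
    obtain ⟨w, hw⟩ := (PadicInt.isUnit_iff.2 hn1).exists_right_inv
    refine ⟨w * a, ⟨a, ⟨h₁, h₂, h₃⟩, by rw [← mul_assoc, hw, one_mul]⟩, ?_⟩
    rwa [← one_mul ‖x - w * a‖, ← hn1, ← norm_mul, mul_sub, ← mul_assoc, hw, one_mul]
  · rintro ⟨y, ⟨a, ⟨h₁, h₂, h₃⟩, ha⟩, hy⟩
    refine ⟨a, h₁, h₂, h₃, ?_⟩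
    rwa [ha, ← mul_sub, norm_mul, hn1, one_mul]

theorem eventually_padicApprox_eq_univ {c : ℝ} (hc : 0 < c) :
    ∀ᶠ n : ℕ in atTop, ¬ p ∣ n → ∀ x, x ∈ padicApprox p n c (-1) 1 := by
  obtain ⟨k, hk⟩ := PadicInt.exists_pow_neg_lt p hc
  have hM : 0 < p ^ k := pow_pos (Fact.out : p.Prime).pos k
  have hM' : (0 : ℝ) < (p ^ k : ℕ) := by exact_mod_cast hM
  filter_upwards [exists_coprime_mem_Icc_of_large
    (c := 1 / (2 * (p ^ k : ℕ))) (by positivity), eventually_ge_atTop (2 * p ^ k)] with n hn hnM hpn x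
  set v : ℕ := ((n : ℤ_[p]) * x).appr k
  have hvlt : v < p ^ k := PadicInt.appr_lt _ _
  have hv : ‖(n : ℤ_[p]) * x - v‖ ≤ (p : ℝ) ^ (-k : ℤ) :=
    (PadicInt.norm_le_pow_iff_mem_span_pow _ _).2 (PadicInt.appr_spec k _)
  have hcop : IsCoprime ((p ^ k : ℕ) : ℤ) n :=
    Nat.isCoprime_iff_coprime.2
      (Nat.Coprime.pow_left k ((Nat.Prime.coprime_iff_not_dvd Fact.out).2 hpn))
  obtain ⟨s, t, hst⟩ := hcop
  obtain ⟨b, h₁, h₂, h₃⟩ := hn ((s * v : ℤ) : ℝ)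
  set a : ℤ := v + (p ^ k : ℕ) * (b - s * v)
  have hbc : (((p ^ k : ℕ) * (b - s * v : ℤ) : ℤ) : ℝ) ≤ n / 2 := by
    push_cast at h₁ h₂ hM' ⊢
    have : (b : ℝ) - s * v ≤ 1 / (2 * p ^ k) * n := by linarith
    calc (p : ℝ) ^ k * (b - s * v) ≤ p ^ k * (1 / (2 * p ^ k) * n) := by gcongr
      _ = n / 2 := by field_simp
  have hb0 : 0 ≤ ((p ^ k : ℕ) : ℤ) * (b - s * v) := by
    have : (s * v : ℤ) ≤ b := by exact_mod_cast h₁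
    exact mul_nonneg (by positivity) (by linarith)
  have hnM' : (2 * (p ^ k : ℕ) : ℝ) ≤ n := by exact_mod_cast hnM
  have hv' : (v : ℝ) ≤ (p ^ k : ℕ) := by exact_mod_cast hvlt.le
  refine ⟨a, ?_, ?_, ?_, ?_⟩
  · have : (0 : ℤ) ≤ a := by positivity
    have : (0 : ℝ) ≤ a := by exact_mod_cast this
    have : (0 : ℝ) ≤ n := by positivity
    linarith
  · have : (a : ℝ) = v + (((p ^ k : ℕ) * (b - s * v : ℤ) : ℤ) : ℝ) := by simp [a]
    rw [this]
    linarith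
  · rw [← Int.isCoprime_iff_gcd_eq_one] at h₃ ⊢
    have ha : a = (p ^ k : ℕ) * b + n * (t * v) := by
      simp only [a]
      linear_combination (-(v : ℤ)) * hst
    rw [ha]
    exact (IsCoprime.mul_left ⟨s, t, hst⟩ h₃).add_mul_left_left _
  · refine le_trans ?_ hk.le
    rw [PadicInt.norm_le_pow_iff_mem_span_pow] at hv ⊢
    rw [Ideal.mem_span_singleton] at hv ⊢
    have ha : (n : ℤ_[p]) * x - a = (n * x - v) - p ^ k * ((b - s * v : ℤ) : ℤ_[p]) := by
      simp only [a]
      push_cast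
      ring
    rw [ha]
    exact dvd_sub hv (dvd_mul_right _ _)

/-- The `p`-adic integers within `δ` of a fraction `a / n` in lowest terms with `|a| ≤ n`. -/
def padicFractionApprox (p : ℕ) [Fact p.Prime] (n : ℕ) (δ : ℝ) : Set ℤ_[p] :=
  {x | ∃ a : ℤ, |a| ≤ (n : ℤ) ∧ Int.gcd a n = 1 ∧ ‖(x : ℚ_[p]) - (a : ℚ_[p]) / (n : ℚ_[p])‖ ≤ δ}

theorem padicFractionApprox_eq {n : ℕ} (hn : ¬ p ∣ n) (δ : ℝ) :
    padicFractionApprox p n δ = padicApprox p n δ (-1) 1 := by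
  have hn1 : ‖(n : ℚ_[p])‖ = 1 := by
    have : ‖(n : ℤ_[p])‖ = 1 := by
      rw [PadicInt.norm_natCast_eq_one_iff]
      exact (Nat.Prime.coprime_iff_not_dvd Fact.out).2 hn
    simpa [PadicInt.norm_def] using this
  have hn0 : (n : ℚ_[p]) ≠ 0 := norm_ne_zero_iff.1 (by rw [hn1]; exact one_ne_zero)
  ext x
  refine exists_congr fun a => ?_
  have h₁ : |a| ≤ (n : ℤ) ↔ -1 * (n : ℝ) ≤ a ∧ (a : ℝ) ≤ 1 * n := by
    rw [abs_le, neg_one_mul, one_mul]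
    norm_cast
  have h₂ : ‖(x : ℚ_[p]) - (a : ℚ_[p]) / (n : ℚ_[p])‖ = ‖(n : ℤ_[p]) * x - a‖ := by
    rw [PadicInt.norm_def]
    push_cast
    calc ‖(x : ℚ_[p]) - a / n‖ = ‖(n : ℚ_[p])‖ * ‖(x : ℚ_[p]) - a / n‖ := by rw [hn1, one_mul]
      _ = ‖(n : ℚ_[p]) * x - a‖ := by rw [← norm_mul, mul_sub, mul_div_cancel₀ _ hn0]
  rw [h₁, h₂, and_assoc]

theorem padicFractionApprox_eq_univ_of_mem {n : ℕ} (hn : p ∣ n) (hn0 : 0 < n) {δ : ℝ}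
    {x : ℤ_[p]} (hx : x ∈ padicFractionApprox p n δ) (y : ℤ_[p]) :
    y ∈ padicFractionApprox p n δ := by
  obtain ⟨a, h₁, h₂, h₃⟩ := hx
  refine ⟨a, h₁, h₂, h₃.trans' (le_of_eq ?_)⟩
  have hpa : ¬ (p : ℤ) ∣ a := fun h => by
    have := Int.dvd_coe_gcd h (Int.natCast_dvd_natCast.2 hn)
    rw [h₂] at this
    exact (Fact.out : p.Prime).one_lt.ne'
      (by exact_mod_cast Int.eq_one_of_dvd_one (by positivity) this)
  have ha : ‖(a : ℚ_[p])‖ = 1 := by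
    rw [← PadicInt.norm_intCast_eq_padic_norm]
    refine le_antisymm (PadicInt.norm_le_one _) (not_lt.1 fun h => hpa ?_)
    exact (PadicInt.norm_int_lt_one_iff_dvd a).1 h
  have hn1 : ‖(n : ℚ_[p])‖ < 1 := by
    have := (PadicInt.norm_natCast_lt_one_iff (p := p)).2 hn
    simpa [PadicInt.norm_def] using this
  have hnpos : 0 < ‖(n : ℚ_[p])‖ := norm_pos_iff.2 (by exact_mod_cast hn0.ne')
  have key : ∀ z : ℤ_[p], ‖(z : ℚ_[p]) - (a : ℚ_[p]) / (n : ℚ_[p])‖ = ‖(n : ℚ_[p])‖⁻¹ := by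
    intro z
    have hlt : ‖(z : ℚ_[p])‖ < ‖(a : ℚ_[p]) / n‖ := by
      rw [norm_div, ha, one_div]
      exact z.2.trans_lt ((one_lt_inv₀ hnpos).2 hn1)
    rw [sub_eq_add_neg, Padic.add_eq_max_of_ne (by rw [norm_neg]; exact hlt.ne), norm_neg,
      max_eq_right hlt.le, norm_div, ha, one_div]
  rw [key, key]

variable [MeasurableSpace ℤ_[p]] [BorelSpace ℤ_[p]]

theorem measurableSet_padicLimsup (N : Set ℕ) (r : ℕ → ℝ) (α β : ℝ) :
    MeasurableSet (padicLimsup p N r α β) := by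
  refine measurableSet_frequently (fun n => ?_) N
  refine measurableSet_setOfPred.2 (Measurable.exists fun a => ?_)
  refine measurable_const.and (measurable_const.and (measurable_const.and
    (measurableSet_setOfPred.1 ?_)))
  exact (isClosed_le (by fun_prop) continuous_const).measurableSet

variable (μ : Measure ℤ_[p]) [μ.IsAddHaarMeasure] [IsProbabilityMeasure μ]

theorem measurableEmbedding_p_mul : MeasurableEmbedding fun x : ℤ_[p] => p * x :=
  ((continuous_const_mul (p : ℤ_[p])).isClosedEmbedding
    (mul_right_injective₀ PadicInt.prime_p.ne_zero)).measurableEmbedding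

theorem exists_measure_image_p_mul : ∃ c : ℝ≥0∞, c ≠ 0 ∧ c ≠ ∞ ∧ p * c ≤ 1 ∧
    ∀ s : Set ℤ_[p], μ ((fun x => p * x) '' s) = c * μ s := by
  set f : ℤ_[p] → ℤ_[p] := fun x => p * x with hf
  have hfe : MeasurableEmbedding f := measurableEmbedding_p_mul
  have hcomap : ∀ s, μ.comap f s = μ (f '' s) := fun s => hfe.comap_apply μ s
  have : (μ.comap f).IsAddLeftInvariant := by
    refine ⟨fun g => Measure.ext fun s hs => ?_⟩
    rw [Measure.map_apply (measurable_const_add g) hs, hcomap, hcomap,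
      ← measure_preimage_add μ (f g) (f '' s)]
    congr 1
    ext x
    constructor
    · rintro ⟨y, hy, rfl⟩
      exact ⟨g + y, hy, by simp [hf, mul_add]⟩
    · rintro ⟨y, hy, hyx⟩
      refine ⟨y - g, by simpa using hy, ?_⟩
      simp only [hf] at hyx ⊢
      linear_combination hyx
  have : IsFiniteMeasure (μ.comap f) := ⟨by rw [hcomap]; exact measure_lt_top _ _⟩
  have heq := Measure.isAddLeftInvariant_eq_smul (μ.comap f) μ
  set c := (μ.comap f).addHaarScalarFactor μ
  have hs : ∀ s, μ (f '' s) = c * μ s := fun s => by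
    rw [← hcomap, heq]
    simp
  have hrange : μ (Set.range f) = c := by rw [← Set.image_univ, hs]; simp
  refine ⟨c, ?_, ENNReal.coe_ne_top, ?_, hs⟩
  · rw [← hrange]
    have : Set.range f = {x | ‖x‖ < 1} := by
      ext x
      rw [Set.mem_ofPred_eq, PadicInt.norm_lt_one_iff_dvd]
      exact ⟨fun ⟨y, hy⟩ => ⟨y, hy.symm⟩, fun ⟨y, hy⟩ => ⟨y, hy.symm⟩⟩
    rw [this]
    exact ((isOpen_lt continuous_norm continuous_const).measure_pos μ ⟨0, by simp⟩).ne'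
  · have hdisj : Set.PairwiseDisjoint (Finset.range p : Set ℕ)
        fun b => (fun x => ((-b : ℤ) : ℤ_[p]) + x) ⁻¹' Set.range f := by
      intro b hb b' hb' hne
      refine Set.disjoint_left.2 ?_
      rintro x ⟨y, hy⟩ ⟨y', hy'⟩
      have hd : (p : ℤ) ∣ (b : ℤ) - b' := by
        rw [← PadicInt.norm_intCast_lt_one_iff (p := p), PadicInt.norm_lt_one_iff_dvd]
        refine ⟨y' - y, ?_⟩
        simp only [hf] at hy hy'
        push_cast at hy hy' ⊢
        linear_combination hy - hy'
      refine hne ?_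
      have hm := (Int.modEq_iff_dvd.2 hd).symm
      rw [Int.natCast_modEq_iff] at hm
      exact hm.eq_of_lt_of_lt (Finset.mem_range.1 hb) (Finset.mem_range.1 hb')
    calc (p : ℝ≥0∞) * c = ∑ b ∈ Finset.range p,
          μ ((fun x => ((-b : ℤ) : ℤ_[p]) + x) ⁻¹' Set.range f) := by
          simp [measure_preimage_add, hrange]
      _ = μ (⋃ b ∈ Finset.range p, (fun x => ((-b : ℤ) : ℤ_[p]) + x) ⁻¹' Set.range f) :=
          (measure_biUnion_finset hdisj fun b _ =>
            measurable_const_add _ hfe.measurableSet_range).symm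
      _ ≤ 1 := prob_le_one

/-- If all the pieces of `s` under the contractions `x ↦ b + p * x` have measure at most `S`,
then so does `s`. -/
theorem measure_le_of_forall_measure_preimage_le {s : Set ℤ_[p]} {S : ℝ≥0∞}
    (h : ∀ b : ℕ, μ {x | b + p * x ∈ s} ≤ S) : μ s ≤ S := by
  obtain ⟨c, -, -, hc, hμ⟩ := exists_measure_image_p_mul μ
  have hcover : s ⊆ ⋃ b ∈ Finset.range p,
      (fun x => ((-b : ℤ) : ℤ_[p]) + x) ⁻¹' ((fun x => p * x) '' {x | b + p * x ∈ s}) := by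
    intro x hx
    obtain ⟨b, hb, hbx⟩ := PadicInt.exists_mem_range x
    obtain ⟨y, hy⟩ := (PadicInt.norm_lt_one_iff_dvd _).1 (PadicInt.mem_nonunits.1 hbx)
    simp only [Set.mem_iUnion]
    refine ⟨b, Finset.mem_range.2 hb, y, ?_, ?_⟩
    · rw [Set.mem_ofPred_eq, ← hy]
      simpa using hx
    · simp only [← hy]
      push_cast
      ring
  calc μ s ≤ ∑ b ∈ Finset.range p,
        μ ((fun x => ((-b : ℤ) : ℤ_[p]) + x) ⁻¹' ((fun x => p * x) '' {x | b + p * x ∈ s})) :=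
        (measure_mono hcover).trans (measure_biUnion_finset_le _ _)
    _ = ∑ b ∈ Finset.range p, c * μ {x | b + p * x ∈ s} := by
        simp only [measure_preimage_add, hμ]
    _ ≤ ∑ b ∈ Finset.range p, c * S := by gcongr; exact h _
    _ = p * c * S := by simp [mul_assoc]
    _ ≤ 1 * S := by gcongr
    _ = S := one_mul S

theorem isUnifLocDoublingMeasure_padicInt : IsUnifLocDoublingMeasure μ := by
  obtain ⟨c, hc0, hct, -, hμ⟩ := exists_measure_image_p_mul μ
  refine ⟨c⁻¹.toNNReal, ?_⟩
  filter_upwards [self_mem_nhdsWithin] with ε (hε : 0 < ε) x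
  rw [ENNReal.coe_toNNReal (ENNReal.inv_ne_top.2 hc0), ← ENNReal.div_eq_inv_mul,
    ENNReal.le_div_iff_mul_le (Or.inl hc0) (Or.inl hct), mul_comm, ← hμ]
  have hp : (2 : ℝ) ≤ p := by exact_mod_cast (Fact.out : p.Prime).two_le
  calc μ ((fun x => p * x) '' Metric.closedBall x (2 * ε))
      ≤ μ (Metric.closedBall (p * x) ε) := by
        refine measure_mono ?_
        rintro _ ⟨y, hy, rfl⟩
        rw [Metric.mem_closedBall, dist_eq_norm] at hy ⊢
        rw [← mul_sub, norm_mul, PadicInt.norm_p, inv_mul_le_iff₀ (by linarith)]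
        nlinarith
    _ = μ (Metric.closedBall x ε) := by
        rw [← measure_preimage_add μ (p * x - x) (Metric.closedBall (p * x) ε)]
        congr 1
        ext y
        simp only [Set.mem_preimage, Metric.mem_closedBall, dist_eq_norm]
        congr! 2
        ring

theorem padicLimsup_p_mul_ae_eq {N : Set ℕ} (hN : ∀ n ∈ N, ¬ p ∣ n) {r : ℕ → ℝ}
    (hr0 : ∀ n, 0 ≤ r n) (hr : Tendsto r atTop (nhds 0)) (α β : ℝ) :
    padicLimsup p N (fun n => p * r n) α β =ᵐ[μ] padicLimsup p N r α β := by
  have := isUnifLocDoublingMeasure_padicInt μ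
  have hp : (0 : ℝ) < p := by exact_mod_cast (Fact.out : p.Prime).pos
  have key : ∀ r' : ℕ → ℝ, (∀ n, 0 ≤ r' n) → padicLimsup p N r' α β =
      blimsup (fun n => Metric.cthickening (r' n) ((fun y : ℤ_[p] => n * y) ⁻¹'
      ((fun a : ℤ => (a : ℤ_[p])) '' {a | α * n ≤ a ∧ (a : ℝ) ≤ β * n ∧ Int.gcd a n = 1})))
      atTop (· ∈ N) := by
    intro r' hr'
    ext x
    rw [mem_blimsup_atTop_iff]
    refine frequently_congr (Eventually.of_forall fun n => and_congr_right fun hn => ?_)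
    rw [padicApprox_eq_cthickening (hN n hn) (hr' n)]
  rw [key _ hr0, key _ fun n => mul_nonneg hp.le (hr0 n)]
  exact blimsup_cthickening_mul_ae_eq μ (· ∈ N) _ hp r hr

theorem measure_padicLimsup_le {N : Set ℕ} (hN : ∀ n ∈ N, ¬ p ∣ n) {r : ℕ → ℝ}
    (hr0 : ∀ n, 0 ≤ r n) (hr : Tendsto r atTop (nhds 0)) (j : ℕ) (α : ℝ) :
    μ (padicLimsup p N r α (α + p ^ j)) ≤ μ (padicLimsup p N r (-1) 1) := by
  have hp : (0 : ℝ) < p := by exact_mod_cast (Fact.out : p.Prime).pos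
  induction j generalizing α with
  | zero =>
    set m : ℤ := -(⌊α⌋ + 1)
    have hm : (m : ℝ) = -(⌊α⌋ + 1) := by simp [m]
    have h₁ := Int.floor_le α
    have h₂ := Int.lt_floor_add_one α
    have hset : padicLimsup p N r α (α + p ^ 0) = (fun x => (m : ℤ_[p]) + x) ⁻¹'
        padicLimsup p N r (α + m) (α + p ^ 0 + m) := by
      ext x
      exact (add_intCast_mem_padicLimsup_iff m).symm
    rw [hset, measure_preimage_add]
    refine measure_mono (padicLimsup_mono ?_ ?_) <;> rw [hm] <;> linarith
  | succ j ih =>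
    refine measure_le_of_forall_measure_preimage_le μ fun b => ?_
    have hsub : {x : ℤ_[p] | b + p * x ∈ padicLimsup p N r α (α + p ^ (j + 1))} ⊆
        padicLimsup p N (fun n => p * r n) ((α - b) / p) ((α + p ^ (j + 1) - b) / p) :=
      fun x hx => mem_padicLimsup_of_add_p_mul_mem hr b (Set.mem_ofPred_eq ▸ hx)
    have heq : (α + p ^ (j + 1) - b) / p = (α - b) / p + p ^ j := by
      field_simp
      ring
    rw [heq] at hsub
    exact (measure_mono hsub).trans <|
      (measure_congr (padicLimsup_p_mul_ae_eq μ hN hr0 hr _ _)).trans_le (ih _)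

theorem padicLimsup_ae_empty_or_univ {N : Set ℕ} (hN : ∀ n ∈ N, ¬ p ∣ n) {r : ℕ → ℝ}
    (hr0 : ∀ n, 0 ≤ r n) (hr : Tendsto r atTop (nhds 0)) :
    (∀ᵐ x ∂μ, x ∉ padicLimsup p N r (-1) 1) ∨ ∀ᵐ x ∂μ, x ∈ padicLimsup p N r (-1) 1 := by
  set V : ℕ → Set ℤ_[p] := fun M => padicLimsup p N r (-M) M with hV
  have hVmono : Monotone V := fun M M' h => by
    have : (M : ℝ) ≤ M' := by exact_mod_cast h
    exact padicLimsup_mono (by linarith) this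
  have hle : μ (⋃ M, V M) ≤ μ (padicLimsup p N r (-1) 1) := by
    rw [hVmono.measure_iUnion]
    refine iSup_le fun M => (measure_mono (padicLimsup_mono le_rfl ?_)).trans
      (measure_padicLimsup_le μ hN hr0 hr (2 * M) (-M))
    have : 2 * M ≤ p ^ (2 * M) := (Nat.lt_pow_self (Fact.out : p.Prime).one_lt).le
    have : (2 * M : ℝ) ≤ p ^ (2 * M) := by exact_mod_cast this
    linarith
  have hsub : padicLimsup p N r (-1) 1 ⊆ ⋃ M, V M := by
    refine fun x hx => Set.mem_iUnion.2 ⟨1, ?_⟩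
    simpa [hV] using hx
  have hmeas : MeasurableSet (⋃ M, V M) :=
    MeasurableSet.iUnion fun M => measurableSet_padicLimsup N r _ _
  have hshift : ∀ (m : ℤ), |m| ≤ 1 → ∀ x ∈ ⋃ M, V M, (m : ℤ_[p]) + x ∈ ⋃ M, V M := by
    intro m hm x hx
    obtain ⟨M, hM⟩ := Set.mem_iUnion.1 hx
    have hm' : |(m : ℝ)| ≤ 1 := by exact_mod_cast hm
    rw [abs_le] at hm'
    refine Set.mem_iUnion.2 ⟨M + 1, padicLimsup_mono ?_ ?_ (add_intCast_mem_padicLimsup hM m)⟩ <;>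
      push_cast <;> linarith
  have hinv : (fun x : ℤ_[p] => 1 + x) ⁻¹' (⋃ M, V M) = ⋃ M, V M := by
    ext x
    refine ⟨fun h => ?_, fun h => ?_⟩
    · simpa using hshift (-1) (by simp) _ h
    · simpa using hshift 1 (by simp) _ h
  have herg : Ergodic (fun x : ℤ_[p] => 1 + x) μ :=
    ergodic_add_left_of_denseRange_zsmul (by simpa using PadicInt.denseRange_intCast) μ
  rcases eventuallyConst_set'.1 (herg.toPreErgodic.aeconst_set hmeas hinv) with h | h
  · left
    have h0 : μ (⋃ M, V M) = 0 := ae_eq_empty.1 h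
    exact measure_eq_zero_iff_ae_notMem.1 (measure_mono_null hsub h0)
  · right
    have h1 : μ (⋃ M, V M) = 1 := by rw [measure_congr h, measure_univ]
    rw [h1] at hle
    exact (mem_ae_iff_prob_eq_one (measurableSet_padicLimsup N r _ _)).2
      (le_antisymm prob_le_one hle)

theorem measurableSet_padicFractionApprox (n : ℕ) (δ : ℝ) :
    MeasurableSet (padicFractionApprox p n δ) := by
  refine measurableSet_setOfPred.2 (Measurable.exists fun a => ?_)
  refine measurable_const.and (measurable_const.and (measurableSet_setOfPred.1 ?_))
  exact (isClosed_le (by fun_prop) continuous_const).measurableSet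

theorem limsupZeroOne_padicFractionApprox {ψ : ℕ → ℝ} (hψ : ∀ n, 0 ≤ ψ n) :
    LimsupZeroOne μ fun n => padicFractionApprox p n (ψ n) := by
  classical
  refine ⟨fun n => measurableSet_padicFractionApprox n _, fun N => ?_⟩
  by_cases hdiv : ∃ᶠ n in atTop, n ∈ N ∧ p ∣ n ∧ (padicFractionApprox p n (ψ n)).Nonempty
  · refine Or.inr (ae_of_all _ fun x => ?_)
    refine (hdiv.and_eventually (eventually_gt_atTop 0)).mono fun n hn => ⟨hn.1.1, ?_⟩
    obtain ⟨⟨-, hpn, y, hy⟩, hn0⟩ := hn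
    exact padicFractionApprox_eq_univ_of_mem hpn hn0 hy x
  set N' : Set ℕ := {n | n ∈ N ∧ ¬ p ∣ n}
  set r : ℕ → ℝ := fun n => if n ∈ N' then ψ n else 0 with hr
  have hr0 : ∀ n, 0 ≤ r n := fun n => by simp only [hr]; split_ifs <;> simp [hψ]
  have hrN : ∀ n, 0 < r n → n ∈ N' := fun n h => by
    by_contra hn
    simp [hr, hn] at h
  have hrψ : ∀ n ∈ N', r n = ψ n := fun n hn => by simp [hr, hn]
  have hiff : ∀ x, (∃ᶠ n in atTop, n ∈ N ∧ x ∈ padicFractionApprox p n (ψ n)) ↔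
      x ∈ padicLimsup p N' r (-1) 1 := by
    intro x
    refine frequently_congr ((not_frequently.1 hdiv).mono fun n hn => ⟨fun h => ?_, fun h => ?_⟩)
    · have hpn : ¬ p ∣ n := fun hpn => hn ⟨h.1, hpn, x, h.2⟩
      have hnN : n ∈ N' := ⟨h.1, hpn⟩
      rw [padicFractionApprox_eq hpn, ← hrψ n hnN] at h
      exact ⟨hnN, h.2⟩
    · rw [padicFractionApprox_eq h.1.2, ← hrψ n h.1]
      exact ⟨h.1.1, h.2⟩
  simp only [hiff]
  by_cases ht : Tendsto r atTop (nhds 0)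
  · exact padicLimsup_ae_empty_or_univ μ (fun n hn => hn.2) hr0 ht
  · obtain ⟨c, hc, hfr⟩ := exists_frequently_le_of_not_tendsto_zero hr0 ht
    refine Or.inr (ae_of_all _ fun x => ?_)
    refine (hfr.and_eventually (eventually_padicApprox_eq_univ (p := p) hc)).mono fun n hn => ?_
    have hnN := hrN n (hc.trans_le hn.1)
    obtain ⟨a, h₁, h₂, h₃, h₄⟩ := hn.2 hnN.2 x
    exact ⟨hnN, a, h₁, h₂, h₃, h₄.trans hn.1⟩

end Padic

/-- **Lemma 1 (Haynes): the zero-one law.** Let `ℓ ≥ 0`, `k ≥ 1`, and let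
`p_1, …, p_k` be (not necessarily distinct) primes.  For every non-negative `ψ`, the
measure of `W_{ℓ,p_1,…,p_k}(ψ)` is `0` or `1`. -/
theorem stmt9 (ℓ k : ℕ) (hk : 1 ≤ k)
    (P : Fin k → ℕ) [∀ i, Fact (P i).Prime]
    [∀ i, MeasurableSpace ℤ_[P i]] [∀ i, BorelSpace ℤ_[P i]]
    (μs : (i : Fin k) → Measure ℤ_[P i])
    [∀ i, (μs i).IsAddHaarMeasure] [∀ i, IsProbabilityMeasure (μs i)]
    (ψ : ℕ → ℝ) (hψ : ∀ n, 0 ≤ ψ n) :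
    prodMeasure ℓ k P μs (prodW ℓ k P ψ) = 0 ∨
      prodMeasure ℓ k P μs (prodW ℓ k P ψ) = 1 := by
  have : IsProbabilityMeasure (volume : Measure UnitAddCircle) := ⟨UnitAddCircle.measure_univ⟩
  have h := (LimsupZeroOne.pi (μ := fun _ : Fin ℓ => (volume : Measure UnitAddCircle))
    fun _ => limsupZeroOne_circleApprox hψ).prod
    (LimsupZeroOne.pi fun i => limsupZeroOne_padicFractionApprox (μs i) hψ)
  have hiff : ∀ x, x ∈ prodW ℓ k P ψ ↔ ∃ᶠ n in atTop, n ∈ Set.univ ∧ x ∈ prodE ℓ k P ψ n := by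
    intro x
    simp only [Set.mem_univ, true_and]
    exact Nat.frequently_atTop_iff_infinite.symm
  have : IsProbabilityMeasure (prodMeasure ℓ k P μs) := by
    unfold prodMeasure
    infer_instance
  rcases h.2 Set.univ with h | h
  · left
    refine measure_eq_zero_iff_ae_notMem.2 ?_
    filter_upwards [h] with x hx hxW
    exact hx ((hiff x).1 hxW)
  · right
    have hW : prodW ℓ k P ψ =ᵐ[prodMeasure ℓ k P μs] Set.univ := by
      refine eventuallyEq_univ.2 ?_
      filter_upwards [h] with x hx
      exact (hiff x).2 hx
    rw [measure_congr hW, measure_univ]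
end
end

section
/- Let p be a fixed prime and suppose that (QIA_p) holds. Then (QIA_∞, ψ) holds for every non-negative function ψ : ℕ → ℝ which satisfies Σ_{n∈ℕ} λ(A_n(ψ)) = ∞ and ψ(n) = 0 for all n divisible by p. -/
open MeasureTheory Filter

noncomputable section

/-- The set `E_n(ψ) ⊆ ℤ_p`: union over integers `a` with `|a| ≤ n`, `gcd(a,n) = 1`
of the closed balls `{x : |x - a/n|_p ≤ ψ(n)}`. -/
def padicE (p : ℕ) [Fact p.Prime] (ψ : ℕ → ℝ) (n : ℕ) : Set ℤ_[p] :=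
  {x | ∃ a : ℤ, |a| ≤ (n : ℤ) ∧ Int.gcd a n = 1 ∧
    ‖(x : ℚ_[p]) - (a : ℚ_[p]) / (n : ℚ_[p])‖ ≤ ψ n}

/-- The set `A_n(ψ) ⊆ ℝ/ℤ`: union over `1 ≤ a ≤ n`, `gcd(a,n) = 1` of the closed
intervals `[a/n - ψ(n), a/n + ψ(n)]` taken mod 1. -/
def circleA (ψ : ℕ → ℝ) (n : ℕ) : Set UnitAddCircle :=
  {x | ∃ a : ℕ, 1 ≤ a ∧ a ≤ n ∧ Nat.gcd a n = 1 ∧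
    ‖x - (((a : ℝ) / (n : ℝ) : ℝ) : UnitAddCircle)‖ ≤ ψ n}

/-- `(QIA_∞, ψ)` holds: quasi-independence on average in `ℝ/ℤ` for `ψ`. -/
def QIAinftyFor (ψ : ℕ → ℝ) : Prop :=
  0 < atTop.limsup (fun N : ℕ =>
    (∑ n ∈ Finset.Icc 1 N, volume (circleA ψ n)) ^ 2 /
      ∑ m ∈ Finset.Icc 1 N, ∑ n ∈ Finset.Icc 1 N, volume (circleA ψ m ∩ circleA ψ n))

/-- `(QIA_p)` holds for the Haar probability measure `μ` on `ℤ_p`: quasi-independence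
on average holds for every non-negative `ψ` with divergent sum of measures. -/
def QIApHolds (p : ℕ) [Fact p.Prime] [MeasurableSpace ℤ_[p]] (μ : Measure ℤ_[p]) : Prop :=
  ∀ ψ : ℕ → ℝ, (∀ n, 0 ≤ ψ n) → (∑' n : ℕ, μ (padicE p ψ n)) = ⊤ →
    0 < atTop.limsup (fun N : ℕ =>
      (∑ n ∈ Finset.Icc 1 N, μ (padicE p ψ n)) ^ 2 /
        ∑ m ∈ Finset.Icc 1 N, ∑ n ∈ Finset.Icc 1 N, μ (padicE p ψ m ∩ padicE p ψ n))

theorem sum_range_mul_of_periodic {A B : ℕ} (hA : 0 < A) (hB : 0 < B) (hAB : A.Coprime B)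
    {F G : ℕ → ℝ} (hF : Function.Periodic F A) (hG : Function.Periodic G B) :
    ∑ x ∈ Finset.range (A * B), F x * G x =
      (∑ x ∈ Finset.range A, F x) * ∑ x ∈ Finset.range B, G x := by
  rw [Finset.sum_mul_sum, ← Finset.sum_product']
  refine Finset.sum_bij (fun x _ => (x % A, x % B)) ?_ ?_ ?_ ?_
  · intro x _
    simp [Nat.mod_lt _ hA, Nat.mod_lt _ hB]
  · intro x hx y hy hxy
    simp only [Prod.mk.injEq] at hxy
    have h : x ≡ y [MOD A * B] := (Nat.modEq_and_modEq_iff_modEq_mul hAB).1 hxy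
    exact Nat.ModEq.eq_of_lt_of_lt h (Finset.mem_range.1 hx) (Finset.mem_range.1 hy)
  · rintro ⟨a, b⟩ hab
    simp only [Finset.mem_product, Finset.mem_range] at hab
    refine ⟨Nat.chineseRemainder hAB a b, ?_, ?_⟩
    · exact Finset.mem_range.2 (Nat.chineseRemainder_lt_mul hAB a b hA.ne' hB.ne')
    · have h := (Nat.chineseRemainder hAB a b).2
      simp only [Prod.mk.injEq]
      exact ⟨by rw [h.1, Nat.mod_eq_of_lt hab.1], by rw [h.2, Nat.mod_eq_of_lt hab.2]⟩
  · intro x _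
    rw [hF.map_mod_nat, hG.map_mod_nat]

theorem periodic_prod_primes {S : Finset ℕ} {f : ℕ → ℕ → ℝ}
    (hf : ∀ q ∈ S, Function.Periodic (f q) q) :
    Function.Periodic (fun x => ∏ q ∈ S, f q x) (∏ q ∈ S, q) := by
  intro x
  refine Finset.prod_congr rfl fun q hq => ?_
  obtain ⟨c, hc⟩ := Finset.dvd_prod_of_mem (fun q => q) hq
  rw [hc, mul_comm]
  exact (hf q hq).nat_mul c x

theorem sum_range_prod_primes {S : Finset ℕ} (hS : ∀ q ∈ S, q.Prime) {f : ℕ → ℕ → ℝ}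
    (hf : ∀ q ∈ S, Function.Periodic (f q) q) :
    ∑ x ∈ Finset.range (∏ q ∈ S, q), ∏ q ∈ S, f q x =
      ∏ q ∈ S, ∑ x ∈ Finset.range q, f q x := by
  induction S using Finset.induction_on with
  | empty => simp
  | insert r S hr ih =>
    have hS' : ∀ q ∈ S, q.Prime := fun q hq => hS q (Finset.mem_insert_of_mem hq)
    have hf' : ∀ q ∈ S, Function.Periodic (f q) q := fun q hq => hf q (Finset.mem_insert_of_mem hq)
    have hrp := hS r (Finset.mem_insert_self _ _)
    simp only [Finset.prod_insert hr]
    rw [← ih hS' hf']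
    refine sum_range_mul_of_periodic hrp.pos (Finset.prod_pos fun q hq => (hS' q hq).pos) ?_
      (hf r (Finset.mem_insert_self _ _)) (periodic_prod_primes hf')
    refine Nat.Coprime.prod_right fun q hq => ?_
    exact (Nat.coprime_primes hrp (hS' q hq)).2 fun h => hr (h ▸ hq)

theorem sum_range_mul_prod_primes {S : Finset ℕ} (hS : ∀ q ∈ S, q.Prime) {f : ℕ → ℕ → ℝ}
    (hf : ∀ q ∈ S, Function.Periodic (f q) q) (B : ℕ) :
    ∑ x ∈ Finset.range ((∏ q ∈ S, q) * B), ∏ q ∈ S, f q x =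
      B * ∏ q ∈ S, ∑ x ∈ Finset.range q, f q x := by
  induction B with
  | zero => simp
  | succ B ih =>
    rw [Nat.mul_succ, Finset.sum_range_add, ih, ← sum_range_prod_primes hS hf]
    have h : ∀ x, ∏ q ∈ S, f q ((∏ q ∈ S, q) * B + x) = ∏ q ∈ S, f q x := by
      intro x
      have := (periodic_prod_primes hf).nat_mul B x
      rwa [add_comm x, mul_comm] at this
    simp only [h]
    push_cast
    ring

theorem prod_inv_one_sub_inv_le_exp {N B z : ℕ} (hN : 0 < N) (hNB : N ≤ 2 ^ (B * (z + 1))) :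
    ∏ q ∈ N.primeFactors with z < q, (1 - (q : ℝ)⁻¹)⁻¹ ≤ Real.exp (2 * B) := by
  set S := N.primeFactors.filter (z < ·) with hSdef
  have hcard : S.card ≤ B * (z + 1) := by
    have h1 : 2 ^ S.card ≤ ∏ q ∈ S, q :=
      Finset.pow_card_le_prod _ _ _ fun q hq =>
        (Nat.prime_of_mem_primeFactors (Finset.mem_filter.1 hq).1).two_le
    have h2 : ∏ q ∈ S, q ≤ N := by
      refine Nat.le_of_dvd hN (dvd_trans ?_ (Nat.prod_primeFactors_dvd N))
      exact Finset.prod_dvd_prod_of_subset _ _ _ (Finset.filter_subset _ _)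
    exact (Nat.pow_le_pow_iff_right (by norm_num)).1 (h1.trans (h2.trans hNB))
  have hz : (0 : ℝ) < z + 1 := by positivity
  have hterm : ∀ q ∈ S, (1 - (q : ℝ)⁻¹)⁻¹ ≤ Real.exp (2 / (z + 1)) := by
    intro q hq
    have hq1 := (Nat.prime_of_mem_primeFactors (Finset.mem_filter.1 hq).1).two_le
    have hq2 : z + 1 ≤ q := (Finset.mem_filter.1 hq).2
    have hq1' : (2 : ℝ) ≤ q := by exact_mod_cast hq1
    have hq2' : (z : ℝ) + 1 ≤ q := by exact_mod_cast hq2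
    have h1 : (1 - (q : ℝ)⁻¹)⁻¹ = 1 / (q - 1) + 1 := by
      have : (q : ℝ) - 1 ≠ 0 := by linarith
      field_simp
      ring
    have h2 : 1 / ((q : ℝ) - 1) ≤ 2 / (z + 1) := by
      rw [div_le_div_iff₀ (by linarith) hz]
      linarith
    rw [h1]
    exact (add_le_add_left h2 1).trans (Real.add_one_le_exp _)
  have hpos : ∀ q ∈ S, 0 ≤ (1 - (q : ℝ)⁻¹)⁻¹ := by
    intro q hq
    have hq1 := (Nat.prime_of_mem_primeFactors (Finset.mem_filter.1 hq).1).one_lt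
    have : (q : ℝ)⁻¹ ≤ 1 := inv_le_one_of_one_le₀ (by exact_mod_cast hq1.le)
    exact inv_nonneg.2 (by linarith)
  calc ∏ q ∈ S, (1 - (q : ℝ)⁻¹)⁻¹ ≤ ∏ _q ∈ S, Real.exp (2 / (z + 1)) :=
        Finset.prod_le_prod hpos hterm
    _ = Real.exp (S.card * (2 / (z + 1))) := by rw [Finset.prod_const, ← Real.exp_nat_mul]
    _ ≤ Real.exp (2 * B) := by
      refine Real.exp_le_exp.2 ?_
      have : (S.card : ℝ) ≤ B * (z + 1) := by exact_mod_cast hcard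
      rw [mul_div_assoc', div_le_iff₀ hz]
      linarith

theorem prod_one_add_inv_mul_pred_le_exp {S : Finset ℕ} (hS : ∀ q ∈ S, q.Prime) :
    ∏ q ∈ S, (1 + 1 / ((q : ℝ) * (q - 1))) ≤ Real.exp 1 := by
  have htel : ∀ N : ℕ, ∑ q ∈ Finset.range N, (if 2 ≤ q then 1 / ((q : ℝ) * (q - 1)) else 0) ≤
      1 - (if 2 ≤ N then 1 / ((N : ℝ) - 1) else 1) := by
    intro N
    induction N with
    | zero => simp
    | succ N ih =>
      rw [Finset.sum_range_succ]
      rcases Nat.lt_or_ge N 2 with h | h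
      · interval_cases N
        · simp
        · norm_num [Finset.sum_range_succ]
      · have hN : (2 : ℝ) ≤ N := by exact_mod_cast h
        simp only [h, if_true, (by omega : 2 ≤ N + 1)] at ih ⊢
        have : 1 / ((N : ℝ) * (N - 1)) = 1 / ((N : ℝ) - 1) - 1 / (((N + 1 : ℕ) : ℝ) - 1) := by
          have : (N : ℝ) - 1 ≠ 0 := by linarith
          have : (N : ℝ) ≠ 0 := by linarith
          push_cast
          rw [add_sub_cancel_right]
          field_simp
          ring
        linarith
  obtain ⟨N, hN⟩ := S.exists_nat_subset_range
  have hnn : ∀ q : ℕ, (0 : ℝ) ≤ if 2 ≤ q then 1 / ((q : ℝ) * (q - 1)) else 0 := by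
    intro q
    split_ifs with h
    · have : (2 : ℝ) ≤ q := by exact_mod_cast h
      have : 0 ≤ (q : ℝ) - 1 := by linarith
      positivity
    · rfl
  calc ∏ q ∈ S, (1 + 1 / ((q : ℝ) * (q - 1)))
      ≤ ∏ q ∈ S, Real.exp (if 2 ≤ q then 1 / ((q : ℝ) * (q - 1)) else 0) := by
        refine Finset.prod_le_prod (fun q hq => ?_) fun q hq => ?_
        · have := hnn q
          rw [if_pos (hS q hq).two_le] at this
          linarith
        · rw [if_pos (hS q hq).two_le, add_comm]
          exact Real.add_one_le_exp _
    _ = Real.exp (∑ q ∈ S, if 2 ≤ q then 1 / ((q : ℝ) * (q - 1)) else 0) :=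
        (Real.exp_sum _ _).symm
    _ ≤ Real.exp 1 := by
      refine Real.exp_le_exp.2 ?_
      refine (Finset.sum_le_sum_of_subset_of_nonneg hN fun q _ _ => hnn q).trans ?_
      refine (htel N).trans ?_
      split_ifs with h
      · have : (2 : ℝ) ≤ N := by exact_mod_cast h
        have : 0 ≤ 1 / ((N : ℝ) - 1) := one_div_nonneg.2 (by linarith)
        linarith
      · norm_num

/-- The local factor at `q` of the number of representations of `s` by reduced fractions, where `r`
is the product of the non-common parts of the two denominators. -/
def coprimeWeight (r s q : ℕ) : ℝ :=
  if q ∣ r then (if q ∣ s then 0 else 1) else (if q ∣ s then 1 else 1 - (q : ℝ)⁻¹)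

theorem coprimeWeight_nonneg {r s q : ℕ} (hq : q.Prime) : 0 ≤ coprimeWeight r s q := by
  have : (q : ℝ)⁻¹ ≤ 1 := inv_le_one_of_one_le₀ (by exact_mod_cast hq.one_lt.le)
  unfold coprimeWeight
  split_ifs <;> linarith

theorem coprimeWeight_le_one (r s q : ℕ) : coprimeWeight r s q ≤ 1 := by
  have : 0 ≤ (q : ℝ)⁻¹ := by positivity
  unfold coprimeWeight
  split_ifs <;> linarith

theorem coprimeWeight_periodic (r q : ℕ) :
    Function.Periodic (fun s => coprimeWeight r s q) q := by
  intro s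
  simp [coprimeWeight]

theorem exists_lt_dvd_add_mul {q : ℕ} (hq : q.Prime) (x : ℤ) {y : ℕ} (hy : ¬ q ∣ y) :
    ∃ t < q, (q : ℤ) ∣ x + y * t := by
  have : Fact q.Prime := ⟨hq⟩
  have hy0 : (y : ZMod q) ≠ 0 := by rwa [Ne, ZMod.natCast_eq_zero_iff]
  refine ⟨(-(x : ZMod q) / y).val, ZMod.val_lt _, ?_⟩
  rw [← ZMod.intCast_zmod_eq_zero_iff_dvd]
  push_cast
  rw [ZMod.natCast_zmod_val]
  field_simp
  ring

theorem sum_range_avoid_le {m₁ n₁ q : ℕ} (hmn : m₁.Coprime n₁) (hq : q.Prime) {x y s : ℤ}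
    (hs : x * m₁ - y * n₁ = s) (hqs : q ∣ m₁ * n₁ → ¬ q ∣ s.natAbs) :
    ∑ t ∈ Finset.range q, (if (q : ℤ) ∣ x + n₁ * t ∨ (q : ℤ) ∣ y + m₁ * t then (0 : ℝ) else 1) ≤
      ((q : ℝ) - 1) * coprimeWeight (m₁ * n₁) s.natAbs q := by
  have hq0 : (0 : ℝ) < q := by exact_mod_cast hq.pos
  have key : ∀ U : Finset ℕ, U ⊆ Finset.range q →
      (∀ t ∈ U, (q : ℤ) ∣ x + n₁ * t ∨ (q : ℤ) ∣ y + m₁ * t) →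
      ∑ t ∈ Finset.range q,
        (if (q : ℤ) ∣ x + n₁ * t ∨ (q : ℤ) ∣ y + m₁ * t then (0 : ℝ) else 1) ≤ q - U.card := by
    intro U hU hUd
    have h1 := Finset.sum_sdiff (f := fun t : ℕ =>
      (if (q : ℤ) ∣ x + n₁ * t ∨ (q : ℤ) ∣ y + m₁ * t then (0 : ℝ) else 1)) hU
    have h2 : ∑ t ∈ U, (if (q : ℤ) ∣ x + n₁ * t ∨ (q : ℤ) ∣ y + m₁ * t then (0 : ℝ) else 1) = 0 :=
      Finset.sum_eq_zero fun t ht => if_pos (hUd t ht)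
    have h3 : ∑ t ∈ Finset.range q \ U,
        (if (q : ℤ) ∣ x + n₁ * t ∨ (q : ℤ) ∣ y + m₁ * t then (0 : ℝ) else 1) ≤
        ((Finset.range q \ U).card : ℝ) := by
      refine (Finset.sum_le_card_nsmul _ _ 1 fun t _ => ?_).trans (by simp)
      split_ifs <;> norm_num
    rw [Finset.card_sdiff_of_subset hU, Nat.cast_sub (Finset.card_le_card hU),
      Finset.card_range] at h3
    linarith
  by_cases hqr : q ∣ m₁ * n₁
  · have hw : coprimeWeight (m₁ * n₁) s.natAbs q = 1 := by
      rw [coprimeWeight, if_pos hqr, if_neg (hqs hqr)]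
    have hex : ∃ t < q, (q : ℤ) ∣ x + n₁ * t ∨ (q : ℤ) ∣ y + m₁ * t := by
      by_cases hqn : q ∣ n₁
      · have hqm : ¬ q ∣ m₁ := fun h => hq.not_dvd_one (hmn ▸ Nat.dvd_gcd h hqn)
        obtain ⟨t, ht, h⟩ := exists_lt_dvd_add_mul hq y hqm
        exact ⟨t, ht, Or.inr h⟩
      · obtain ⟨t, ht, h⟩ := exists_lt_dvd_add_mul hq x hqn
        exact ⟨t, ht, Or.inl h⟩
    obtain ⟨t, ht, h⟩ := hex
    have := key {t} (by simpa using ht) (by simpa using h)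
    rw [hw]
    simpa using this
  · have hqn : ¬ q ∣ n₁ := fun h => hqr (h.mul_left _)
    have hqm : ¬ q ∣ m₁ := fun h => hqr (h.mul_right _)
    obtain ⟨t, ht, h⟩ := exists_lt_dvd_add_mul hq x hqn
    by_cases hq_s : q ∣ s.natAbs
    · rw [coprimeWeight, if_neg hqr, if_pos hq_s]
      have := key {t} (by simpa using ht) (by simp [h])
      simpa using this
    · rw [coprimeWeight, if_neg hqr, if_neg hq_s]
      obtain ⟨u, hu, h'⟩ := exists_lt_dvd_add_mul hq y hqm
      have htu : t ≠ u := by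
        rintro rfl
        apply hq_s
        rw [← Int.natCast_dvd, ← hs]
        have : x * m₁ - y * n₁ = (x + n₁ * t) * m₁ - (y + m₁ * t) * n₁ := by ring
        rw [this]
        exact dvd_sub (h.mul_right _) (h'.mul_right _)
      have := key {t, u} (by
        intro v hv
        simp only [Finset.mem_insert, Finset.mem_singleton] at hv
        rcases hv with rfl | rfl <;> simpa) (by
        intro v hv
        simp only [Finset.mem_insert, Finset.mem_singleton] at hv
        rcases hv with rfl | rfl
        · exact Or.inl h
        · exact Or.inr h')
      rw [Finset.card_pair htu] at this
      refine this.trans ?_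
      have h4 : ((q : ℝ) - 1) * (1 - (q : ℝ)⁻¹) = q - 2 + (q : ℝ)⁻¹ := by
        field_simp
        ring
      have h5 : 0 ≤ (q : ℝ)⁻¹ := by positivity
      rw [h4]
      push_cast
      linarith

/-- The number of reduced fractions `a / (g n₁)` for which there is a reduced `b / (g m₁)` with
`a m₁ - b n₁ = s`. -/
theorem card_fiber_le {g m₁ n₁ : ℕ} (hg : 0 < g) (hm : 0 < m₁) (hn : 0 < n₁)
    (hmn : m₁.Coprime n₁) (s : ℤ) (T : Finset ℕ)
    (hT : ∀ a ∈ T, 1 ≤ a ∧ a ≤ g * n₁ ∧ (∀ q : ℕ, q.Prime → q ∣ g * n₁ → ¬ (q : ℤ) ∣ a) ∧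
      ∃ b : ℤ, a * m₁ - b * n₁ = s ∧ ∀ q : ℕ, q.Prime → q ∣ g * m₁ → ¬ (q : ℤ) ∣ b) :
    (T.card : ℝ) ≤ g.totient *
      ∏ q ∈ (g * (m₁ * n₁)).primeFactors, coprimeWeight (m₁ * n₁) s.natAbs q := by
  have hprime : ∀ q ∈ g.primeFactors, q.Prime := fun q hq => Nat.prime_of_mem_primeFactors hq
  rcases T.eq_empty_or_nonempty with rfl | ⟨a₀, ha₀⟩
  · rw [Finset.card_empty, Nat.cast_zero]
    exact mul_nonneg (Nat.cast_nonneg _) (Finset.prod_nonneg fun q hq =>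
      coprimeWeight_nonneg (Nat.prime_of_mem_primeFactors hq))
  obtain ⟨h1, -, h3, b₀, hb, h4⟩ := hT a₀ ha₀
  have hqs : ∀ q : ℕ, q.Prime → q ∣ m₁ * n₁ → ¬ q ∣ s.natAbs := by
    intro q hq hqr hq_s
    rw [← Int.natCast_dvd, ← hb] at hq_s
    have hqI : Prime (q : ℤ) := Nat.prime_iff_prime_int.1 hq
    rcases (hq.dvd_mul).1 hqr with h | h
    · have h' : (q : ℤ) ∣ m₁ := Int.natCast_dvd_natCast.2 h
      have : (q : ℤ) ∣ b₀ * n₁ := by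
        have := dvd_sub (h'.mul_left (a₀ : ℤ)) hq_s
        simpa using this
      rcases hqI.dvd_or_dvd this with h5 | h5
      · exact h4 q hq (h.mul_left _) h5
      · exact hq.not_dvd_one (hmn ▸ Nat.dvd_gcd h (Int.natCast_dvd_natCast.1 h5))
    · have h' : (q : ℤ) ∣ n₁ := Int.natCast_dvd_natCast.2 h
      have : (q : ℤ) ∣ a₀ * m₁ := by
        have := dvd_add hq_s (h'.mul_left b₀)
        simpa using this
      rcases hqI.dvd_or_dvd this with h5 | h5
      · exact h3 q hq (h.mul_left _) h5
      · exact hq.not_dvd_one (hmn ▸ Nat.dvd_gcd (Int.natCast_dvd_natCast.1 h5) h)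
  have hprod : ∏ q ∈ (g * (m₁ * n₁)).primeFactors, coprimeWeight (m₁ * n₁) s.natAbs q =
      ∏ q ∈ g.primeFactors, coprimeWeight (m₁ * n₁) s.natAbs q := by
    have hr : m₁ * n₁ ≠ 0 := (Nat.mul_pos hm hn).ne'
    symm
    refine Finset.prod_subset (Nat.primeFactors_mono (Dvd.intro _ rfl) (mul_ne_zero hg.ne' hr)) ?_
    intro q hq hqg
    rw [Nat.primeFactors_mul hg.ne' hr, Finset.mem_union] at hq
    have hq' := hq.resolve_left hqg
    have hqp := Nat.prime_of_mem_primeFactors hq'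
    have hqd := Nat.dvd_of_mem_primeFactors hq'
    rw [coprimeWeight, if_pos hqd, if_neg (hqs q hqp hqd)]
  set t₀ : ℤ := (((a₀ - 1) / n₁ : ℕ) : ℤ) with ht₀
  set x : ℤ := a₀ - n₁ * t₀ with hx
  set y : ℤ := b₀ - m₁ * t₀ with hy
  have hxy : x * m₁ - y * n₁ = s := by rw [hx, hy, ← hb]; ring
  set f : ℕ → ℕ → ℝ := fun q t =>
    if (q : ℤ) ∣ x + n₁ * t ∨ (q : ℤ) ∣ y + m₁ * t then 0 else 1 with hf
  have hfper : ∀ q ∈ g.primeFactors, Function.Periodic (f q) q := by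
    intro q _ t
    have e1 : (q : ℤ) ∣ x + n₁ * ((t + q : ℕ) : ℤ) ↔ (q : ℤ) ∣ x + n₁ * t := by
      have : x + n₁ * ((t + q : ℕ) : ℤ) = x + n₁ * t + n₁ * q := by push_cast; ring
      rw [this]
      exact dvd_add_left (Dvd.intro_left _ rfl)
    have e2 : (q : ℤ) ∣ y + m₁ * ((t + q : ℕ) : ℤ) ↔ (q : ℤ) ∣ y + m₁ * t := by
      have : y + m₁ * ((t + q : ℕ) : ℤ) = y + m₁ * t + m₁ * q := by push_cast; ring
      rw [this]
      exact dvd_add_left (Dvd.intro_left _ rfl)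
    simp only [hf, e1, e2]
  obtain ⟨B, hB⟩ := Nat.prod_primeFactors_dvd g
  have hpos : 0 < ∏ q ∈ g.primeFactors, q := Finset.prod_pos fun q hq => (hprime q hq).pos
  have htot : (g.totient : ℝ) = B * ∏ q ∈ g.primeFactors, ((q : ℝ) - 1) := by
    rw [Nat.totient_eq_div_primeFactors_mul]
    rw [Nat.div_eq_of_eq_mul_right hpos hB]
    push_cast
    congr 1
    refine Finset.prod_congr rfl fun q hq => ?_
    rw [Nat.cast_sub (hprime q hq).one_lt.le, Nat.cast_one]
  have hcard : (T.card : ℝ) ≤ ∑ t ∈ Finset.range g, ∏ q ∈ g.primeFactors, f q t := by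
    have hclass : ∀ a ∈ T, (a : ℤ) = x + n₁ * ((a - 1) / n₁ : ℕ) := by
      intro a ha
      obtain ⟨ha1, -, -, b, hab, -⟩ := hT a ha
      have hd : (n₁ : ℤ) ∣ (a : ℤ) - a₀ := by
        have h : (n₁ : ℤ) ∣ ((a : ℤ) - a₀) * m₁ := ⟨b - b₀, by linear_combination hab - hb⟩
        exact (Nat.isCoprime_iff_coprime.2 hmn.symm).dvd_of_dvd_mul_right h
      have hmod : (a - 1) % n₁ = (a₀ - 1) % n₁ := by
        have : (a₀ - 1) ≡ (a - 1) [MOD n₁] := by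
          rw [Nat.modEq_iff_dvd]
          rw [Nat.cast_sub ha1, Nat.cast_sub h1]
          simpa using hd
        exact this.symm
      have e1 := Nat.div_add_mod (a - 1) n₁
      have e2 := Nat.div_add_mod (a₀ - 1) n₁
      rw [hmod] at e1
      rw [hx, ht₀]
      have e1' : (n₁ : ℤ) * ((a - 1) / n₁ : ℕ) + ((a₀ - 1) % n₁ : ℕ) = a - 1 := by
        have := congrArg (Nat.cast : ℕ → ℤ) e1
        rw [Nat.cast_sub ha1] at this
        exact_mod_cast this
      have e2' : (n₁ : ℤ) * ((a₀ - 1) / n₁ : ℕ) + ((a₀ - 1) % n₁ : ℕ) = a₀ - 1 := by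
        have := congrArg (Nat.cast : ℕ → ℤ) e2
        rw [Nat.cast_sub h1] at this
        exact_mod_cast this
      linarith
    have hinj : Set.InjOn (fun a : ℕ => (a - 1) / n₁) T := by
      intro a ha b hb hab
      have e1 := hclass a ha
      have e2 := hclass b hb
      simp only at hab
      rw [hab, ← e2] at e1
      exact_mod_cast e1
    rw [← Finset.card_image_of_injOn hinj, Finset.card_eq_sum_ones, Nat.cast_sum]
    have hsub : T.image (fun a : ℕ => (a - 1) / n₁) ⊆ Finset.range g := by
      intro t ht
      obtain ⟨a, ha, rfl⟩ := Finset.mem_image.1 ht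
      obtain ⟨ha1, ha2, -⟩ := hT a ha
      rw [Finset.mem_range, Nat.div_lt_iff_lt_mul hn]
      omega
    refine le_trans (Finset.sum_le_sum fun t ht => ?_)
      (Finset.sum_le_sum_of_subset_of_nonneg hsub fun t _ _ => Finset.prod_nonneg fun q _ => ?_)
    · obtain ⟨a, ha, rfl⟩ := Finset.mem_image.1 ht
      obtain ⟨ha1, ha2, ha3, b, hab, hb3⟩ := hT a ha
      have e1 := hclass a ha
      have e2 : b = y + m₁ * ((a - 1) / n₁ : ℕ) := by
        have hn0 : (n₁ : ℤ) ≠ 0 := by exact_mod_cast hn.ne'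
        apply mul_right_cancel₀ hn0
        have : b * n₁ = a * m₁ - s := by linarith
        rw [this, e1, ← hxy]
        ring
      rw [Finset.prod_eq_one]
      · simp
      intro q hq
      simp only [hf]
      rw [← e1, ← e2, if_neg]
      have hqd := Nat.dvd_of_mem_primeFactors hq
      rintro (h | h)
      · exact ha3 q (hprime q hq) (hqd.mul_right _) h
      · exact hb3 q (hprime q hq) (hqd.mul_right _) h
    · simp only [hf]
      split_ifs <;> norm_num
  refine hcard.trans ?_
  rw [hprod, htot, mul_assoc, ← Finset.prod_mul_distrib]
  rw [show Finset.range g = Finset.range ((∏ q ∈ g.primeFactors, q) * B) from congrArg _ hB,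
    sum_range_mul_prod_primes hprime hfper]
  refine mul_le_mul_of_nonneg_left (Finset.prod_le_prod (fun q _ => ?_) fun q hq => ?_)
    (Nat.cast_nonneg _)
  · refine Finset.sum_nonneg fun t _ => ?_
    simp only [hf]
    split_ifs <;> norm_num
  · exact sum_range_avoid_le hmn (hprime q hq) hxy (hqs q (hprime q hq))

theorem coprimeWeight_le_mul {r s q : ℕ} (hr : 0 < r) (hs : 0 < s) (hq : q.Prime) :
    coprimeWeight r s q ≤ (1 - (q : ℝ)⁻¹) *
      if q ∈ (r * s).primeFactors then (1 - (q : ℝ)⁻¹)⁻¹ else 1 := by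
  have hlt : (q : ℝ)⁻¹ < 1 := inv_lt_one_of_one_lt₀ (by exact_mod_cast hq.one_lt)
  have hmem : q ∈ (r * s).primeFactors ↔ q ∣ r ∨ q ∣ s := by
    rw [Nat.mem_primeFactors, hq.dvd_mul]
    have := (Nat.mul_pos hr hs).ne'
    tauto
  by_cases h : q ∈ (r * s).primeFactors
  · rw [if_pos h, mul_inv_cancel₀ (by linarith)]
    exact coprimeWeight_le_one _ _ _
  · rw [if_neg h, mul_one]
    rw [hmem, not_or] at h
    rw [coprimeWeight, if_neg h.1, if_neg h.2]

theorem sum_range_coprimeWeight_le {r q : ℕ} (hq : q.Prime) :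
    ∑ s ∈ Finset.range q, coprimeWeight r s q ≤
      q * ((1 - (q : ℝ)⁻¹) * (1 + 1 / ((q : ℝ) * (q - 1)))) := by
  have hq1 : (1 : ℝ) < q := by exact_mod_cast hq.one_lt
  have hq1' : (q : ℝ) - 1 ≠ 0 := by linarith
  have hq0 : (q : ℝ) ≠ 0 := by linarith
  obtain ⟨k, rfl⟩ : ∃ k, q = k + 1 := ⟨q - 1, by have := hq.pos; omega⟩
  have hnd : ∀ s ∈ Finset.range k, ¬ (k + 1) ∣ s + 1 := by
    intro s hs h
    have := Nat.le_of_dvd (Nat.succ_pos _) h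
    have := Finset.mem_range.1 hs
    omega
  rw [Finset.sum_range_succ']
  by_cases hr : (k + 1) ∣ r
  · have h1 : ∀ s ∈ Finset.range k, coprimeWeight r (s + 1) (k + 1) = 1 := fun s hs => by
      rw [coprimeWeight, if_pos hr, if_neg (hnd s hs)]
    rw [Finset.sum_congr rfl h1, coprimeWeight, if_pos hr, if_pos (dvd_zero _)]
    simp only [Finset.sum_const, Finset.card_range, nsmul_eq_mul, mul_one, add_zero]
    push_cast at *
    have hk : (k : ℝ) ≠ 0 := by simpa using hq1'
    have hk0 : (0 : ℝ) ≤ k := Nat.cast_nonneg _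
    have : ((k : ℝ) + 1) * ((1 - ((k : ℝ) + 1)⁻¹) * (1 + 1 / (((k : ℝ) + 1) * (k + 1 - 1)))) =
        k + ((k : ℝ) + 1)⁻¹ := by
      rw [add_sub_cancel_right]
      field_simp
      ring
    rw [this]
    have : 0 ≤ ((k : ℝ) + 1)⁻¹ := by positivity
    linarith
  · have h1 : ∀ s ∈ Finset.range k, coprimeWeight r (s + 1) (k + 1) =
        1 - ((k + 1 : ℕ) : ℝ)⁻¹ := fun s hs => by
      rw [coprimeWeight, if_neg hr, if_neg (hnd s hs)]
    rw [Finset.sum_congr rfl h1, coprimeWeight, if_neg hr, if_pos (dvd_zero _)]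
    simp only [Finset.sum_const, Finset.card_range, nsmul_eq_mul]
    push_cast at *
    have hk : (k : ℝ) ≠ 0 := by simpa using hq1'
    refine le_of_eq ?_
    rw [add_sub_cancel_right]
    field_simp
    ring

theorem sum_prod_coprimeWeight_le {D : Finset ℕ} (hD : ∀ q ∈ D, q.Prime) {r Y E : ℕ} (hr : 0 < r)
    (hY : 0 < Y) (hrY : r ≤ (2 ^ E * (Y + 1)) ^ 2) :
    ∑ s ∈ Finset.Icc 1 Y, ∏ q ∈ D, coprimeWeight r s q ≤
      2 * Real.exp (2 * (2 * E + 6) + 1) * Y * ∏ q ∈ D, (1 - (q : ℝ)⁻¹) := by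
  set z := Nat.log 4 Y with hz
  have hz1 : 4 ^ z ≤ Y := Nat.pow_log_le_self 4 hY.ne'
  have hz2 : Y < 4 ^ (z + 1) := Nat.lt_pow_succ_log_self (by norm_num) Y
  set D₁ := D.filter (· ≤ z) with hD₁
  set D₂ := D.filter (fun q => ¬ q ≤ z) with hD₂
  have hp₁ : ∀ q ∈ D₁, q.Prime := fun q hq => hD q (Finset.mem_filter.1 hq).1
  have hp₂ : ∀ q ∈ D₂, q.Prime := fun q hq => hD q (Finset.mem_filter.1 hq).1
  have hfac : ∀ q : ℕ, q.Prime → 0 < 1 - (q : ℝ)⁻¹ := fun q hq =>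
    sub_pos.2 (inv_lt_one_of_one_lt₀ (by exact_mod_cast hq.one_lt))
  set K := ∏ q ∈ D₁, q with hK
  have hK0 : 0 < K := Finset.prod_pos fun q hq => (hp₁ q hq).pos
  have hKY : K ≤ Y := by
    refine le_trans ?_ ((primorial_le_four_pow z).trans hz1)
    refine Nat.le_of_dvd (Finset.prod_pos fun q hq => (Finset.mem_filter.1 hq).2.pos) ?_
    refine Finset.prod_dvd_prod_of_subset _ _ _ fun q hq => ?_
    rw [Finset.mem_filter, Finset.mem_range]
    exact ⟨Nat.lt_succ_of_le (Finset.mem_filter.1 hq).2, hp₁ q hq⟩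
  -- the large primes contribute a bounded factor for every `s`
  have htail : ∀ s ∈ Finset.Icc 1 Y, ∏ q ∈ D₂, coprimeWeight r s q ≤
      Real.exp (2 * (2 * E + 6)) * ∏ q ∈ D₂, (1 - (q : ℝ)⁻¹) := by
    intro s hs
    obtain ⟨hs1, hs2⟩ := Finset.mem_Icc.1 hs
    have hrs : r * s ≤ 2 ^ ((2 * E + 6) * (z + 1)) := by
      have h4 : ∀ k : ℕ, 4 ^ k = 2 ^ (2 * k) := fun k => by rw [pow_mul]; norm_num
      calc r * s ≤ (2 ^ E * 4 ^ (z + 1)) ^ 2 * 4 ^ (z + 1) := by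
            refine Nat.mul_le_mul (hrY.trans ?_) (hs2.trans hz2.le)
            exact Nat.pow_le_pow_left (Nat.mul_le_mul_left _ hz2) 2
        _ = 2 ^ (2 * E + 6 * (z + 1)) := by
            rw [h4, mul_pow, ← pow_mul, ← pow_mul, ← pow_add, ← pow_add]
            ring_nf
        _ ≤ 2 ^ ((2 * E + 6) * (z + 1)) := by
            refine Nat.pow_le_pow_right (by norm_num) ?_
            nlinarith
    have hbig := prod_inv_one_sub_inv_le_exp (Nat.mul_pos hr hs1) hrs
    push_cast at hbig
    calc ∏ q ∈ D₂, coprimeWeight r s q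
        ≤ ∏ q ∈ D₂, ((1 - (q : ℝ)⁻¹) *
            if q ∈ (r * s).primeFactors then (1 - (q : ℝ)⁻¹)⁻¹ else 1) :=
          Finset.prod_le_prod (fun q hq => coprimeWeight_nonneg (hp₂ q hq))
            fun q hq => coprimeWeight_le_mul hr hs1 (hp₂ q hq)
      _ = (∏ q ∈ D₂, (1 - (q : ℝ)⁻¹)) *
            ∏ q ∈ D₂ with q ∈ (r * s).primeFactors, (1 - (q : ℝ)⁻¹)⁻¹ := by
          rw [Finset.prod_mul_distrib, Finset.prod_filter (· ∈ (r * s).primeFactors)]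
      _ ≤ (∏ q ∈ D₂, (1 - (q : ℝ)⁻¹)) * Real.exp (2 * (2 * E + 6)) := by
          refine mul_le_mul_of_nonneg_left (le_trans ?_ hbig)
            (Finset.prod_nonneg fun q hq => (hfac q (hp₂ q hq)).le)
          refine Finset.prod_le_prod_of_subset_of_one_le ?_ (fun q hq => ?_) fun q hq _ => ?_
          · intro q hq
            simp only [hD₂, Finset.mem_filter, not_le] at hq ⊢
            exact ⟨hq.2, hq.1.2⟩
          · exact inv_nonneg.2 (hfac q (hp₂ q (Finset.mem_filter.1 hq).1)).le
          · have hqp := Nat.prime_of_mem_primeFactors (Finset.mem_filter.1 hq).1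
            refine (one_le_inv₀ (hfac q hqp)).2 ?_
            have : 0 ≤ (q : ℝ)⁻¹ := by positivity
            linarith
      _ = _ := mul_comm _ _
  -- the small primes are handled by summing over full periods
  set B := Y / K + 1 with hB
  have hKB1 : Y < K * B := by
    rw [hB, mul_add, mul_one]
    exact Nat.lt_mul_div_succ Y hK0
  have hKB2 : K * B ≤ 2 * Y := by
    have := Nat.mul_div_le Y K
    rw [hB, mul_add, mul_one]
    omega
  have hnn : ∀ s, 0 ≤ ∏ q ∈ D₁, coprimeWeight r s q := fun s =>
    Finset.prod_nonneg fun q hq => coprimeWeight_nonneg (hp₁ q hq)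
  have hsmall : ∑ s ∈ Finset.Icc 1 Y, ∏ q ∈ D₁, coprimeWeight r s q ≤
      2 * Y * ((∏ q ∈ D₁, (1 - (q : ℝ)⁻¹)) * Real.exp 1) := by
    calc ∑ s ∈ Finset.Icc 1 Y, ∏ q ∈ D₁, coprimeWeight r s q
        ≤ ∑ s ∈ Finset.range (K * B), ∏ q ∈ D₁, coprimeWeight r s q := by
          refine Finset.sum_le_sum_of_subset_of_nonneg (fun s hs => ?_) fun s _ _ => hnn s
          exact Finset.mem_range.2 ((Finset.mem_Icc.1 hs).2.trans_lt hKB1)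
      _ = B * ∏ q ∈ D₁, ∑ s ∈ Finset.range q, coprimeWeight r s q :=
          sum_range_mul_prod_primes (f := fun q s => coprimeWeight r s q) hp₁
            (fun q _ => coprimeWeight_periodic r q) B
      _ ≤ B * ∏ q ∈ D₁, (q * ((1 - (q : ℝ)⁻¹) * (1 + 1 / ((q : ℝ) * (q - 1))))) := by
          refine mul_le_mul_of_nonneg_left (Finset.prod_le_prod (fun q hq => ?_) fun q hq => ?_)
            (Nat.cast_nonneg _)
          · exact Finset.sum_nonneg fun s _ => coprimeWeight_nonneg (hp₁ q hq)
          · exact sum_range_coprimeWeight_le (hp₁ q hq)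
      _ = (K * B : ℕ) * ((∏ q ∈ D₁, (1 - (q : ℝ)⁻¹)) *
            ∏ q ∈ D₁, (1 + 1 / ((q : ℝ) * (q - 1)))) := by
          rw [Finset.prod_mul_distrib, Finset.prod_mul_distrib, hK]
          push_cast
          ring
      _ ≤ 2 * Y * ((∏ q ∈ D₁, (1 - (q : ℝ)⁻¹)) * Real.exp 1) := by
          have h0 : 0 ≤ ∏ q ∈ D₁, (1 - (q : ℝ)⁻¹) :=
            Finset.prod_nonneg fun q hq => (hfac q (hp₁ q hq)).le
          refine mul_le_mul (by exact_mod_cast hKB2)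
            (mul_le_mul_of_nonneg_left (prod_one_add_inv_mul_pred_le_exp hp₁) h0) ?_ (by positivity)
          refine mul_nonneg h0 (Finset.prod_nonneg fun q hq => ?_)
          have : (1 : ℝ) < q := by exact_mod_cast (hp₁ q hq).one_lt
          have : 0 < (q : ℝ) - 1 := by linarith
          positivity
  calc ∑ s ∈ Finset.Icc 1 Y, ∏ q ∈ D, coprimeWeight r s q
      = ∑ s ∈ Finset.Icc 1 Y,
          (∏ q ∈ D₁, coprimeWeight r s q) * ∏ q ∈ D₂, coprimeWeight r s q :=
        Finset.sum_congr rfl fun s _ => (Finset.prod_filter_mul_prod_filter_not D _ _).symm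
    _ ≤ ∑ s ∈ Finset.Icc 1 Y, (∏ q ∈ D₁, coprimeWeight r s q) *
          (Real.exp (2 * (2 * E + 6)) * ∏ q ∈ D₂, (1 - (q : ℝ)⁻¹)) :=
        Finset.sum_le_sum fun s hs => mul_le_mul_of_nonneg_left (htail s hs) (hnn s)
    _ ≤ 2 * Y * ((∏ q ∈ D₁, (1 - (q : ℝ)⁻¹)) * Real.exp 1) *
          (Real.exp (2 * (2 * E + 6)) * ∏ q ∈ D₂, (1 - (q : ℝ)⁻¹)) := by
        rw [← Finset.sum_mul]
        refine mul_le_mul_of_nonneg_right hsmall (mul_nonneg (Real.exp_pos _).le ?_)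
        exact Finset.prod_nonneg fun q hq => (hfac q (hp₂ q hq)).le
    _ = _ := by
        rw [← Finset.prod_filter_mul_prod_filter_not D (· ≤ z) (fun q => 1 - (q : ℝ)⁻¹),
          Real.exp_add]
        ring

/-- A Pollington–Vaughan type estimate: the number of pairs of distinct reduced fractions with
denominators `n` and `m` which are within `Δ` of each other modulo one, when `Δ` is not much
smaller than `1 / min m n`. -/
theorem card_close_fractions_le (E : ℕ) {m n : ℕ} (hm : 0 < m) (hn : 0 < n) {Δ : ℝ}
    (hΔm : 1 ≤ 2 ^ E * (Δ * m)) (hΔn : 1 ≤ 2 ^ E * (Δ * n)) (T : Finset (ℕ × ℕ))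
    (hT : ∀ x ∈ T, (1 ≤ x.1 ∧ x.1 ≤ n ∧ x.1.Coprime n) ∧ (1 ≤ x.2 ∧ x.2 ≤ m ∧ x.2.Coprime m) ∧
      ∃ z : ℤ, (x.1 * m - (x.2 + z * m) * n : ℤ) ≠ 0 ∧
        |((x.1 * m - (x.2 + z * m) * n : ℤ) : ℝ)| ≤ m * n * Δ) :
    (T.card : ℝ) ≤
      4 * Real.exp (2 * (2 * E + 6) + 1) * (m.totient * n.totient * Δ) := by
  have hm' : (0 : ℝ) < m := by exact_mod_cast hm
  have hn' : (0 : ℝ) < n := by exact_mod_cast hn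
  have hΔ : 0 < Δ := by
    by_contra! h
    have : 2 ^ E * (Δ * n) ≤ 0 :=
      mul_nonpos_of_nonneg_of_nonpos (by positivity) (mul_nonpos_of_nonpos_of_nonneg h hn'.le)
    linarith
  obtain ⟨g, m₁, n₁, hg, hmn, hmg, hng⟩ := Nat.exists_coprime' (Nat.gcd_pos_of_pos_left n hm)
  have hm₁ : 0 < m₁ := Nat.pos_of_mul_pos_right (hmg ▸ hm)
  have hn₁ : 0 < n₁ := Nat.pos_of_mul_pos_right (hng ▸ hn)
  have hg' : (0 : ℝ) < g := by exact_mod_cast hg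
  have hmgR : (m : ℝ) = m₁ * g := by exact_mod_cast hmg
  have hngR : (n : ℝ) = n₁ * g := by exact_mod_cast hng
  have hmgZ : (m : ℤ) = m₁ * g := by exact_mod_cast hmg
  have hngZ : (n : ℤ) = n₁ * g := by exact_mod_cast hng
  set X : ℝ := g * m₁ * n₁ * Δ with hX
  have hX0 : 0 ≤ X := by positivity
  set Y := ⌊X⌋₊ with hYdef
  have hT3 : ∀ x : ℕ × ℕ, ∃ z : ℤ, x ∈ T → (x.1 * m - (x.2 + z * m) * n : ℤ) ≠ 0 ∧
        |((x.1 * m - (x.2 + z * m) * n : ℤ) : ℝ)| ≤ m * n * Δ := by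
    intro x
    by_cases hx : x ∈ T
    · obtain ⟨z, hz⟩ := (hT x hx).2.2
      exact ⟨z, fun _ => hz⟩
    · exact ⟨0, fun h => absurd h hx⟩
  choose z hz using hT3
  set S : ℕ × ℕ → ℤ := fun x => x.1 * m₁ - (x.2 + z x * m) * n₁ with hS
  have hSg : ∀ x, (x.1 * m - (x.2 + z x * m) * n : ℤ) = g * S x := by
    intro x
    have : ∀ w : ℤ, (x.1 * m - w * n : ℤ) = g * (x.1 * m₁ - w * n₁) := by
      intro w
      rw [hmgZ, hngZ]
      ring
    exact this _
  have hSY : ∀ x ∈ T, (S x).natAbs ∈ Finset.Icc 1 Y := by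
    intro x hx
    obtain ⟨h1, h2⟩ := hz x hx
    rw [hSg] at h1 h2
    have hne : S x ≠ 0 := right_ne_zero_of_mul h1
    rw [Finset.mem_Icc]
    refine ⟨Int.natAbs_pos.2 hne, Nat.le_floor ?_⟩
    rw [Nat.cast_natAbs, Int.cast_abs]
    push_cast at h2
    rw [abs_mul, abs_of_pos hg'] at h2
    have : (m : ℝ) * n * Δ = g * X := by
      rw [hX, hmgR, hngR]
      ring
    rw [this] at h2
    exact le_of_mul_le_mul_left h2 hg'
  set r := m₁ * n₁ with hr
  have hr0 : 0 < r := Nat.mul_pos hm₁ hn₁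
  set D := (g * r).primeFactors with hDdef
  have hD : ∀ q ∈ D, q.Prime := fun q hq => Nat.prime_of_mem_primeFactors hq
  have hfiber : ∀ σ : ℤ, (({x ∈ T | S x = σ} : Finset (ℕ × ℕ)).card : ℝ) ≤
      g.totient * ∏ q ∈ D, coprimeWeight r σ.natAbs q := by
    intro σ
    have hinj : Set.InjOn Prod.fst (({x ∈ T | S x = σ} : Finset (ℕ × ℕ)) : Set (ℕ × ℕ)) := by
      intro x hx y hy hxy
      simp only [Finset.coe_filter, Set.mem_ofPred_eq] at hx hy
      have hxs := hx.2
      have hys := hy.2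
      simp only [hS] at hxs hys
      rw [hxy] at hxs
      have hn0 : (n₁ : ℤ) ≠ 0 := by exact_mod_cast hn₁.ne'
      have h1 : (x.2 + z x * m : ℤ) = y.2 + z y * m := by
        apply mul_right_cancel₀ hn0
        linarith
      have h2 := (hT x hx.1).2.1
      have h3 := (hT y hy.1).2.1
      have hd : (m : ℤ) ∣ (x.2 : ℤ) - y.2 := ⟨z y - z x, by linear_combination h1⟩
      have h4 : (x.2 : ℤ) - y.2 = 0 := by
        refine Int.eq_zero_of_abs_lt_dvd hd ?_
        rw [abs_lt]
        omega
      refine Prod.ext hxy ?_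
      omega
    rw [← Finset.card_image_of_injOn hinj]
    refine card_fiber_le hg hm₁ hn₁ hmn σ _ fun a ha => ?_
    obtain ⟨x, hx, rfl⟩ := Finset.mem_image.1 ha
    obtain ⟨hxT, hxs⟩ := Finset.mem_filter.1 hx
    obtain ⟨⟨h1, h2, h3⟩, ⟨h4, h5, h6⟩, -⟩ := hT x hxT
    refine ⟨h1, by rwa [mul_comm, ← hng], fun q hq hqn hqa => ?_, x.2 + z x * m, hxs,
      fun q hq hqm hqb => ?_⟩
    · rw [mul_comm, ← hng] at hqn
      exact hq.not_dvd_one (h3 ▸ Nat.dvd_gcd (Int.natCast_dvd_natCast.1 hqa) hqn)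
    · rw [mul_comm, ← hmg] at hqm
      have h7 : (q : ℤ) ∣ x.2 :=
        (dvd_add_left ((Int.natCast_dvd_natCast.2 hqm).mul_left (z x))).1 hqb
      exact hq.not_dvd_one (h6 ▸ Nat.dvd_gcd (Int.natCast_dvd_natCast.1 h7) hqm)
  have hnatAbs : ∀ k : ℕ, (({x ∈ T | (S x).natAbs = k} : Finset (ℕ × ℕ)).card : ℝ) ≤
      2 * (g.totient * ∏ q ∈ D, coprimeWeight r k q) := by
    intro k
    have hsub : ({x ∈ T | (S x).natAbs = k} : Finset (ℕ × ℕ)) ⊆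
        {x ∈ T | S x = k} ∪ {x ∈ T | S x = -k} := by
      intro x hx
      simp only [Finset.mem_union, Finset.mem_filter] at hx ⊢
      rcases Int.natAbs_eq_iff.1 hx.2 with h | h
      · exact Or.inl ⟨hx.1, h⟩
      · exact Or.inr ⟨hx.1, h⟩
    have h1 := hfiber k
    have h2 := hfiber (-k)
    rw [Int.natAbs_natCast] at h1
    rw [Int.natAbs_neg, Int.natAbs_natCast] at h2
    have h3 : (({x ∈ T | (S x).natAbs = k} : Finset (ℕ × ℕ)).card : ℝ) ≤
        ({x ∈ T | S x = k} : Finset (ℕ × ℕ)).card + ({x ∈ T | S x = -k} : Finset (ℕ × ℕ)).card := by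
      exact_mod_cast (Finset.card_le_card hsub).trans (Finset.card_union_le _ _)
    linarith
  have hcard : (T.card : ℝ) ≤
      ∑ k ∈ Finset.Icc 1 Y, 2 * (g.totient * ∏ q ∈ D, coprimeWeight r k q) := by
    rw [Finset.card_eq_sum_card_fiberwise (f := fun x => (S x).natAbs) (t := Finset.Icc 1 Y) hSY]
    push_cast
    exact Finset.sum_le_sum fun k _ => hnatAbs k
  have htot : (m.totient : ℝ) * n.totient * Δ =
      g.totient * (X * ∏ q ∈ D, (1 - (q : ℝ)⁻¹)) := by
    have h1 := Nat.totient_gcd_mul_totient_mul m n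
    have hgcd : m.gcd n = g := by
      rw [hmg, hng, Nat.gcd_mul_right, hmn.gcd_eq_one, one_mul]
    have hmn' : m * n = g * (g * r) := by rw [hmg, hng, hr]; ring
    have hpf : (m * n).primeFactors = D := by
      rw [hmn', hDdef, Nat.primeFactors_mul hg.ne' (Nat.mul_pos hg hr0).ne', Finset.union_eq_right]
      exact Nat.primeFactors_mono (Dvd.intro _ rfl) (Nat.mul_pos hg hr0).ne'
    have h2 := Nat.totient_eq_mul_prod_factors (m * n)
    rw [hpf] at h2
    have h3 : ((m * n).totient : ℝ) = (m * n : ℕ) * ∏ q ∈ D, (1 - (q : ℝ)⁻¹) := by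
      have := congrArg (Rat.cast : ℚ → ℝ) h2
      push_cast at this ⊢
      exact this
    rw [hgcd] at h1
    have h4 : (g.totient : ℝ) * (m * n).totient = m.totient * n.totient * g := by
      exact_mod_cast h1
    have h5 : ((m * n : ℕ) : ℝ) = g * (g * m₁ * n₁) := by
      rw [hmn', hr]
      push_cast
      ring
    rw [h3, h5] at h4
    apply mul_left_cancel₀ hg'.ne'
    rw [hX]
    linear_combination -Δ * h4
  have hP0 : 0 ≤ ∏ q ∈ D, (1 - (q : ℝ)⁻¹) := Finset.prod_nonneg fun q hq =>
    sub_nonneg.2 (inv_le_one_of_one_le₀ (by exact_mod_cast (hD q hq).one_lt.le))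
  rcases Nat.eq_zero_or_pos Y with hY0 | hY0
  · rw [hY0] at hcard
    refine hcard.trans ?_
    simp only [Finset.Icc_eq_empty_of_lt Nat.zero_lt_one, Finset.sum_empty]
    positivity
  have hXY : X < Y + 1 := Nat.lt_floor_add_one X
  have hle : ∀ k : ℕ, (k : ℝ) ≤ 2 ^ E * X → k ≤ 2 ^ E * (Y + 1) := by
    intro k hk
    have : (k : ℝ) ≤ 2 ^ E * (Y + 1) :=
      hk.trans (mul_le_mul_of_nonneg_left hXY.le (by positivity))
    exact_mod_cast this
  have hrY : r ≤ (2 ^ E * (Y + 1)) ^ 2 := by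
    rw [hr, sq]
    refine Nat.mul_le_mul (hle m₁ ?_) (hle n₁ ?_)
    · have := mul_le_mul_of_nonneg_left hΔn (Nat.cast_nonneg m₁)
      rw [hngR, mul_one] at this
      refine this.trans (le_of_eq ?_)
      rw [hX]
      ring
    · have := mul_le_mul_of_nonneg_left hΔm (Nat.cast_nonneg n₁)
      rw [hmgR, mul_one] at this
      refine this.trans (le_of_eq ?_)
      rw [hX]
      ring
  have hmain := sum_prod_coprimeWeight_le hD hr0 hY0 hrY
  calc (T.card : ℝ) ≤ ∑ k ∈ Finset.Icc 1 Y, 2 * (g.totient * ∏ q ∈ D, coprimeWeight r k q) :=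
        hcard
    _ = 2 * g.totient * ∑ k ∈ Finset.Icc 1 Y, ∏ q ∈ D, coprimeWeight r k q := by
        rw [Finset.mul_sum]
        exact Finset.sum_congr rfl fun k _ => by ring
    _ ≤ 2 * g.totient * (2 * Real.exp (2 * (2 * E + 6) + 1) * X * ∏ q ∈ D, (1 - (q : ℝ)⁻¹)) := by
        refine mul_le_mul_of_nonneg_left (hmain.trans ?_) (by positivity)
        refine mul_le_mul_of_nonneg_right ?_ hP0
        exact mul_le_mul_of_nonneg_left (Nat.floor_le hX0) (by positivity)
    _ = _ := by
        rw [htot]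
        ring

theorem lintegral_sum_indicator_sq {α ι : Type*} [MeasurableSpace α] (ν : Measure α)
    (S : Finset ι) {A : ι → Set α} (hA : ∀ i, MeasurableSet (A i)) :
    ∫⁻ x, (∑ i ∈ S, (A i).indicator (1 : α → ENNReal) x) ^ 2 ∂ν =
      ∑ i ∈ S, ∑ j ∈ S, ν (A i ∩ A j) := by
  have hm : ∀ i j, Measurable ((A i ∩ A j).indicator (1 : α → ENNReal)) := fun i j =>
    measurable_one.indicator ((hA i).inter (hA j))
  have h : ∀ x, (∑ i ∈ S, (A i).indicator (1 : α → ENNReal) x) ^ 2 =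
      ∑ i ∈ S, ∑ j ∈ S, (A i ∩ A j).indicator (1 : α → ENNReal) x := by
    intro x
    rw [sq, Finset.sum_mul_sum]
    refine Finset.sum_congr rfl fun i _ => Finset.sum_congr rfl fun j _ => ?_
    rw [Set.inter_indicator_one]
    rfl
  simp only [h]
  rw [lintegral_finsetSum _ fun i _ => Finset.measurable_sum _ fun j _ => hm i j]
  refine Finset.sum_congr rfl fun i _ => ?_
  rw [lintegral_finsetSum _ fun j _ => hm i j]
  exact Finset.sum_congr rfl fun j _ => lintegral_indicator_one ((hA i).inter (hA j))

/-- The Chung–Erdős inequality for finitely many sets. -/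
theorem sq_sum_measure_le {α ι : Type*} [MeasurableSpace α] (ν : Measure α)
    (S : Finset ι) {A : ι → Set α} (hA : ∀ i, MeasurableSet (A i)) :
    (∑ i ∈ S, ν (A i)) ^ 2 ≤ ν (⋃ i ∈ S, A i) * ∑ i ∈ S, ∑ j ∈ S, ν (A i ∩ A j) := by
  set f : α → ENNReal := fun x => ∑ i ∈ S, (A i).indicator (1 : α → ENNReal) x with hf
  set U := ⋃ i ∈ S, A i with hU
  have hUm : MeasurableSet U := Finset.measurableSet_biUnion S fun i _ => hA i
  have hfm : Measurable f := Finset.measurable_sum _ fun i _ => measurable_one.indicator (hA i)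
  have hgm : Measurable (U.indicator (1 : α → ENNReal)) := measurable_one.indicator hUm
  have h1 : ∑ i ∈ S, ν (A i) = ∫⁻ x, (f * U.indicator (1 : α → ENNReal)) x ∂ν := by
    have : ∀ x, (f * U.indicator (1 : α → ENNReal)) x = f x := by
      intro x
      by_cases hx : x ∈ U
      · simp [hx]
      · have h0 : f x = 0 := Finset.sum_eq_zero fun i hi => by
          rw [Set.indicator_of_notMem]
          exact fun h => hx (Set.mem_biUnion hi h)
        rw [Pi.mul_apply, h0, zero_mul]
    rw [lintegral_congr this, hf]
    simp only
    rw [lintegral_finsetSum _ fun i _ => measurable_one.indicator (hA i)]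
    exact Finset.sum_congr rfl fun i _ => (lintegral_indicator_one (hA i)).symm
  have h2 := ENNReal.lintegral_mul_le_Lp_mul_Lq ν Real.HolderConjugate.two_two hfm.aemeasurable
    hgm.aemeasurable
  rw [← h1] at h2
  have h3 : ∫⁻ x, f x ^ (2 : ℝ) ∂ν = ∑ i ∈ S, ∑ j ∈ S, ν (A i ∩ A j) := by
    rw [← lintegral_sum_indicator_sq ν S hA]
    simp [hf]
  have h4 : ∫⁻ x, U.indicator (1 : α → ENNReal) x ^ (2 : ℝ) ∂ν = ν U := by
    rw [← lintegral_indicator_one hUm]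
    refine lintegral_congr fun x => ?_
    by_cases hx : x ∈ U <;> simp [hx]
  rw [h3, h4] at h2
  have h5 := pow_le_pow_left' h2 2
  have h6 : ∀ y : ENNReal, (y ^ (1 / (2 : ℝ))) ^ 2 = y := fun y => by
    rw [← ENNReal.rpow_natCast, ← ENNReal.rpow_mul]
    norm_num
  rwa [mul_pow, h6, h6, mul_comm] at h5

theorem ennreal_add_sq_le (a b : ENNReal) : (a + b) ^ 2 ≤ 2 * a ^ 2 + 2 * b ^ 2 := by
  have key : ∀ a b : ENNReal, a ≤ b → (a + b) ^ 2 ≤ 2 * a ^ 2 + 2 * b ^ 2 := by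
    intro a b hab
    obtain ⟨c, rfl⟩ := exists_add_of_le hab
    have : 2 * a ^ 2 + 2 * (a + c) ^ 2 = (a + (a + c)) ^ 2 + c ^ 2 := by ring
    rw [this]
    exact le_self_add
  rcases le_total a b with h | h
  · exact key a b h
  · rw [add_comm a b, add_comm (2 * a ^ 2)]
    exact key b a h

theorem sum_sum_inter_le_filter {α ι : Type*} [MeasurableSpace α] (ν : Measure α)
    (S : Finset ι) (P : ι → Prop) [DecidablePred P] {A : ι → Set α}
    (hA : ∀ i, MeasurableSet (A i)) :
    ∑ i ∈ S, ∑ j ∈ S, ν (A i ∩ A j) ≤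
      2 * ∑ i ∈ S with P i, ∑ j ∈ S with P j, ν (A i ∩ A j) +
      2 * ∑ i ∈ S with ¬ P i, ∑ j ∈ S with ¬ P j, ν (A i ∩ A j) := by
  have hm : ∀ T : Finset ι,
      Measurable fun x => 2 * (∑ i ∈ T, (A i).indicator (1 : α → ENNReal) x) ^ 2 := fun T =>
    ((Finset.measurable_sum _ fun i _ => measurable_one.indicator (hA i)).pow_const 2).const_mul 2
  have hm' : ∀ T : Finset ι,
      Measurable fun x => (∑ i ∈ T, (A i).indicator (1 : α → ENNReal) x) ^ 2 := fun T =>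
    (Finset.measurable_sum _ fun i _ => measurable_one.indicator (hA i)).pow_const 2
  rw [← lintegral_sum_indicator_sq ν _ hA, ← lintegral_sum_indicator_sq ν _ hA,
    ← lintegral_sum_indicator_sq ν _ hA, ← lintegral_const_mul _ (hm' _),
    ← lintegral_const_mul _ (hm' _), ← lintegral_add_left (hm _)]
  refine lintegral_mono fun x => ?_
  simp only
  rw [← Finset.sum_filter_add_sum_filter_not S P]
  exact ennreal_add_sq_le _ _

/-- The numerators of the reduced fractions in `(0, 1]` with denominator `n`. -/
def reducedNumerators (n : ℕ) : Finset ℕ := {a ∈ Finset.Ico 1 (1 + n) | n.Coprime a}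

/-- The fraction `a / n` as a point of the circle. -/
def circleFrac (n a : ℕ) : UnitAddCircle := (((a : ℝ) / (n : ℝ) : ℝ) : UnitAddCircle)

theorem card_reducedNumerators (n : ℕ) : (reducedNumerators n).card = n.totient :=
  Nat.filter_coprime_Ico_eq_totient n 1

theorem mem_reducedNumerators {n a : ℕ} :
    a ∈ reducedNumerators n ↔ 1 ≤ a ∧ a ≤ n ∧ a.Coprime n := by
  rw [reducedNumerators, Finset.mem_filter, Finset.mem_Ico, Nat.coprime_comm]
  omega

theorem circleA_eq_biUnion (ψ : ℕ → ℝ) (n : ℕ) :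
    circleA ψ n = ⋃ a ∈ reducedNumerators n, Metric.closedBall (circleFrac n a) (ψ n) := by
  ext x
  simp only [circleA, Set.mem_iUnion, mem_reducedNumerators, Metric.mem_closedBall, dist_eq_norm,
    circleFrac, exists_prop, and_assoc]
  rfl

theorem measurableSet_circleA (ψ : ℕ → ℝ) (n : ℕ) : MeasurableSet (circleA ψ n) := by
  rw [circleA_eq_biUnion]
  exact Finset.measurableSet_biUnion _ fun a _ => Metric.isClosed_closedBall.measurableSet

theorem volume_closedBall_circle_le (x : UnitAddCircle) (ε : ℝ) :
    volume (Metric.closedBall x ε) ≤ ENNReal.ofReal (2 * ε) := by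
  rw [AddCircle.volume_closedBall]
  exact ENNReal.ofReal_le_ofReal (min_le_right _ _)

theorem exists_int_of_norm_circleFrac_le {m n a b : ℕ} (hm : 0 < m) (hn : 0 < n) {Δ : ℝ}
    (h : ‖circleFrac n a - circleFrac m b‖ ≤ Δ) :
    ∃ z : ℤ, |((a * m - (b + z * m) * n : ℤ) : ℝ)| ≤ m * n * Δ := by
  have hm' : (0 : ℝ) < m := by exact_mod_cast hm
  have hn' : (0 : ℝ) < n := by exact_mod_cast hn
  rw [circleFrac, circleFrac, ← AddCircle.coe_sub, UnitAddCircle.norm_eq] at h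
  refine ⟨round ((a : ℝ) / n - b / m), ?_⟩
  set z := round ((a : ℝ) / n - b / m)
  have : ((a * m - (b + z * m) * n : ℤ) : ℝ) = m * n * ((a : ℝ) / n - b / m - z) := by
    push_cast
    field_simp
    ring
  rw [this, abs_mul, abs_of_pos (by positivity)]
  exact mul_le_mul_of_nonneg_left h (by positivity)

theorem sub_ne_zero_of_reduced {m n a b : ℕ} (ha : a ∈ reducedNumerators n)
    (hb : b ∈ reducedNumerators m) (hne : m ≠ n ∨ a ≠ b) (z : ℤ) :
    (a * m - (b + z * m) * n : ℤ) ≠ 0 := by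
  rw [mem_reducedNumerators] at ha hb
  intro h0
  have hn : 0 < n := by omega
  have hm : 0 < m := by omega
  have hmn : m = n := by
    apply Nat.dvd_antisymm
    · have h1 : (m : ℤ) ∣ (b + z * m) * n := ⟨a, by linarith⟩
      have h2 : IsCoprime (m : ℤ) (b + z * m) :=
        IsCoprime.add_mul_right_right (Nat.isCoprime_iff_coprime.2 hb.2.2.symm) z
      exact Int.natCast_dvd_natCast.1 (h2.dvd_of_dvd_mul_left h1)
    · have h1 : (n : ℤ) ∣ a * m := ⟨b + z * m, by linarith⟩
      have h2 : IsCoprime (n : ℤ) a := Nat.isCoprime_iff_coprime.2 ha.2.2.symm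
      exact Int.natCast_dvd_natCast.1 (h2.dvd_of_dvd_mul_left h1)
  subst hmn
  have hab := hne.resolve_left (by simp)
  have h1 : (a : ℤ) - b - z * m = 0 := by
    have : ((a : ℤ) - b - z * m) * m = 0 := by linarith
    exact (mul_eq_zero.1 this).resolve_right (by exact_mod_cast hm.ne')
  have h2 : (a : ℤ) - b = 0 := by
    refine Int.eq_zero_of_abs_lt_dvd (m := m) ⟨z, by linarith⟩ ?_
    rw [abs_lt]
    omega
  omega

/-- The constant in the bound for the number of close pairs of fractions. -/
def closePairsConst (E : ℕ) : ℝ := 4 * Real.exp (2 * (2 * E + 6) + 1)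

theorem closePairsConst_pos (E : ℕ) : 0 < closePairsConst E := by
  unfold closePairsConst
  positivity

theorem card_close_pairs_le (E : ℕ) {m n : ℕ} (hm : 0 < m) (hn : 0 < n) {Δ : ℝ}
    (hΔm : 1 ≤ 2 ^ E * (Δ * m)) (hΔn : 1 ≤ 2 ^ E * (Δ * n)) (T : Finset (ℕ × ℕ))
    (hT : ∀ x ∈ T, x.1 ∈ reducedNumerators n ∧ x.2 ∈ reducedNumerators m ∧
      (m ≠ n ∨ x.1 ≠ x.2) ∧ ‖circleFrac n x.1 - circleFrac m x.2‖ ≤ Δ) :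
    (T.card : ℝ) ≤ closePairsConst E * (m.totient * n.totient * Δ) := by
  refine card_close_fractions_le E hm hn hΔm hΔn T fun x hx => ?_
  obtain ⟨h1, h2, h3, h4⟩ := hT x hx
  obtain ⟨z, hz⟩ := exists_int_of_norm_circleFrac_le hm hn h4
  exact ⟨mem_reducedNumerators.1 h1, mem_reducedNumerators.1 h2, z,
    sub_ne_zero_of_reduced h1 h2 h3 z, hz⟩

theorem card_close_pairs_self_le {n : ℕ} (hn : 0 < n) {Δ : ℝ} (hΔ : 0 ≤ Δ) (T : Finset (ℕ × ℕ))
    (hT : ∀ x ∈ T, x.1 ∈ reducedNumerators n ∧ x.2 ∈ reducedNumerators n ∧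
      x.1 ≠ x.2 ∧ ‖circleFrac n x.1 - circleFrac n x.2‖ ≤ Δ) :
    (T.card : ℝ) ≤ closePairsConst 0 * (n.totient * n.totient * Δ) := by
  have hn' : (0 : ℝ) < n := by exact_mod_cast hn
  rcases le_or_gt 1 (Δ * n) with h | h
  · refine card_close_pairs_le 0 hn hn (by simpa using h) (by simpa using h) T fun x hx => ?_
    obtain ⟨h1, h2, h3, h4⟩ := hT x hx
    exact ⟨h1, h2, Or.inr h3, h4⟩
  · have : T = ∅ := by
      rw [Finset.eq_empty_iff_forall_notMem]
      intro x hx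
      obtain ⟨h1, h2, h3, h4⟩ := hT x hx
      obtain ⟨z, hz⟩ := exists_int_of_norm_circleFrac_le hn hn h4
      have h0 := sub_ne_zero_of_reduced h1 h2 (Or.inr h3) z
      have e : (x.1 * n - (x.2 + z * n) * n : ℤ) = (x.1 - (x.2 + z * n)) * n := by ring
      rw [e] at hz h0
      have h5 : (1 : ℝ) ≤ |((x.1 - (x.2 + z * n) : ℤ) : ℝ)| := by
        exact_mod_cast Int.one_le_abs (left_ne_zero_of_mul h0)
      rw [Int.cast_mul, abs_mul, Int.cast_natCast, abs_of_pos hn'] at hz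
      nlinarith
    rw [this, Finset.card_empty, Nat.cast_zero]
    have := closePairsConst_pos 0
    positivity

/-- The overlap of two of the sets is bounded by counting those fractions for the smaller
radius which are close to a fraction for the larger one. -/
theorem volume_circleA_inter_le {ψ : ℕ → ℝ} {m n : ℕ} (hmn : ψ n ≤ ψ m) {G : Finset ℕ}
    (hG : ∀ a ∈ reducedNumerators n, (∃ b ∈ reducedNumerators m,
      ‖circleFrac n a - circleFrac m b‖ ≤ 2 * ψ m) → a ∈ G) :
    volume (circleA ψ m ∩ circleA ψ n) ≤ G.card * ENNReal.ofReal (2 * ψ n) := by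
  have hsub : circleA ψ m ∩ circleA ψ n ⊆
      ⋃ a ∈ G, Metric.closedBall (circleFrac n a) (ψ n) := by
    rintro x ⟨hxm, hxn⟩
    rw [circleA_eq_biUnion] at hxm hxn
    simp only [Set.mem_iUnion, exists_prop] at hxm hxn ⊢
    obtain ⟨b, hb, hxb⟩ := hxm
    obtain ⟨a, ha, hxa⟩ := hxn
    refine ⟨a, hG a ha ⟨b, hb, ?_⟩, hxa⟩
    rw [← dist_eq_norm]
    rw [Metric.mem_closedBall] at hxa hxb
    rw [dist_comm] at hxa
    have := dist_triangle (circleFrac n a) x (circleFrac m b)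
    linarith
  calc volume (circleA ψ m ∩ circleA ψ n)
      ≤ ∑ a ∈ G, volume (Metric.closedBall (circleFrac n a) (ψ n)) :=
        (measure_mono hsub).trans (measure_biUnion_finset_le _ _)
    _ ≤ ∑ _a ∈ G, ENNReal.ofReal (2 * ψ n) :=
        Finset.sum_le_sum fun a _ => volume_closedBall_circle_le _ _
    _ = _ := by rw [Finset.sum_const, nsmul_eq_mul]

/-- The constant in the lower bound for the measure of `circleA ψ n`. -/
def overlapConst : ℝ := 1 + 2 * closePairsConst 0

theorem one_le_overlapConst : 1 ≤ overlapConst := by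
  have := closePairsConst_pos 0
  unfold overlapConst
  linarith

theorem sum_sum_balls_inter_le {n : ℕ} (hn : 0 < n) {r : ℝ} (hr : 0 ≤ r) :
    ∑ a ∈ reducedNumerators n, ∑ b ∈ reducedNumerators n,
      volume (Metric.closedBall (circleFrac n a) r ∩ Metric.closedBall (circleFrac n b) r) ≤
    ENNReal.ofReal (2 * (n.totient * r) * (1 + 2 * closePairsConst 0 * (n.totient * r))) := by
  classical
  set R := reducedNumerators n with hR
  set T := {x ∈ R ×ˢ R | x.1 ≠ x.2 ∧ ‖circleFrac n x.1 - circleFrac n x.2‖ ≤ 2 * r} with hT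
  set D := {x ∈ R ×ˢ R | x.1 = x.2} with hD
  have hTc : (T.card : ℝ) ≤ closePairsConst 0 * (n.totient * n.totient * (2 * r)) := by
    refine card_close_pairs_self_le hn (by positivity) T fun x hx => ?_
    simpa [hT, and_assoc] using hx
  have hDc : D.card = n.totient := by
    rw [← card_reducedNumerators, ← hR, ← Finset.diag_card R]
    congr 1
    ext x
    simp only [hD, Finset.mem_filter, Finset.mem_product, Finset.mem_diag]
    exact ⟨fun h => ⟨h.1.1, h.2⟩, fun h => ⟨⟨h.1, h.2 ▸ h.1⟩, h.2⟩⟩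
  rw [← Finset.sum_product']
  calc ∑ x ∈ R ×ˢ R, volume (Metric.closedBall (circleFrac n x.1) r ∩
          Metric.closedBall (circleFrac n x.2) r)
      = ∑ x ∈ D ∪ T, volume (Metric.closedBall (circleFrac n x.1) r ∩
          Metric.closedBall (circleFrac n x.2) r) := by
        symm
        refine Finset.sum_subset ?_ fun x hx hx' => ?_
        · exact Finset.union_subset (Finset.filter_subset _ _) (Finset.filter_subset _ _)
        · have hne : x.1 ≠ x.2 := fun h => hx' (Finset.mem_union_left _ (by simp [hD, hx, h]))
          have hfar : 2 * r < ‖circleFrac n x.1 - circleFrac n x.2‖ := by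
            by_contra! h
            exact hx' (Finset.mem_union_right _ (Finset.mem_filter.2 ⟨hx, hne, h⟩))
          rw [Set.disjoint_iff_inter_eq_empty.1, measure_empty]
          refine Metric.closedBall_disjoint_closedBall ?_
          rw [dist_eq_norm]
          linarith
    _ ≤ ∑ _x ∈ D ∪ T, ENNReal.ofReal (2 * r) := Finset.sum_le_sum fun x _ =>
        (measure_mono Set.inter_subset_left).trans (volume_closedBall_circle_le _ _)
    _ = ((D ∪ T).card : ENNReal) * ENNReal.ofReal (2 * r) := by
        rw [Finset.sum_const, nsmul_eq_mul]
    _ = ENNReal.ofReal (((D ∪ T).card : ℝ) * (2 * r)) := by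
        rw [ENNReal.ofReal_mul (p := ((D ∪ T).card : ℝ)) (by positivity), ENNReal.ofReal_natCast]
    _ ≤ _ := by
        refine ENNReal.ofReal_le_ofReal ?_
        have h1 : ((D ∪ T).card : ℝ) ≤ n.totient + T.card := by
          rw [← hDc]
          exact_mod_cast Finset.card_union_le D T
        calc ((D ∪ T).card : ℝ) * (2 * r)
            ≤ (n.totient + closePairsConst 0 * (n.totient * n.totient * (2 * r))) * (2 * r) := by
              gcongr
              linarith
          _ = _ := by ring

theorem circleA_eq_univ {ψ : ℕ → ℝ} {n : ℕ} (hn : 0 < n) (h : 1 / 2 ≤ ψ n) :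
    circleA ψ n = Set.univ := by
  rw [circleA_eq_biUnion, Set.eq_univ_iff_forall]
  intro x
  simp only [Set.mem_iUnion, exists_prop]
  refine ⟨1, mem_reducedNumerators.2 ⟨le_rfl, hn, Nat.coprime_one_left n⟩, ?_⟩
  rw [AddCircle.closedBall_eq_univ_of_half_period_le 1 one_ne_zero _ (by simpa using h)]
  trivial

/-- The measure of the union of intervals is comparable to the sum of the measures. -/
theorem min_le_volume_circleA {ψ : ℕ → ℝ} {n : ℕ} (hn : 0 < n) (hψ : 0 ≤ ψ n) :
    ENNReal.ofReal (min 1 (n.totient * ψ n)) ≤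
      ENNReal.ofReal overlapConst * volume (circleA ψ n) := by
  have hκ := one_le_overlapConst
  rcases le_or_gt (1 / 2) (ψ n) with h | h
  · rw [circleA_eq_univ hn h, UnitAddCircle.measure_univ, mul_one]
    exact ENNReal.ofReal_le_ofReal ((min_le_left _ _).trans hκ)
  set M : ℝ := n.totient * ψ n with hM
  have hM0 : 0 ≤ M := by positivity
  rcases hM0.eq_or_lt with h0 | hMpos
  · rw [← h0]
    simp
  set L : ℝ := (volume (circleA ψ n)).toReal with hL
  have hLv : volume (circleA ψ n) = ENNReal.ofReal L :=
    (ENNReal.ofReal_toReal (measure_ne_top _ _)).symm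
  have hL0 : 0 ≤ L := ENNReal.toReal_nonneg
  have hball : ∀ a, volume (Metric.closedBall (circleFrac n a) (ψ n)) =
      ENNReal.ofReal (2 * ψ n) := fun a => by
    rw [AddCircle.volume_closedBall, min_eq_right (by linarith)]
  have h1 := sq_sum_measure_le (volume : Measure UnitAddCircle) (reducedNumerators n)
    (A := fun a => Metric.closedBall (circleFrac n a) (ψ n))
    fun a => Metric.isClosed_closedBall.measurableSet
  have h2 := h1.trans (mul_le_mul_right (sum_sum_balls_inter_le hn hψ) _)
  rw [← circleA_eq_biUnion, hLv] at h2
  simp only [hball] at h2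
  rw [Finset.sum_const, card_reducedNumerators, nsmul_eq_mul, ← ENNReal.ofReal_natCast,
    ← ENNReal.ofReal_mul (by positivity), ← ENNReal.ofReal_pow (by positivity),
    ← ENNReal.ofReal_mul hL0, ← hM] at h2
  have hC := closePairsConst_pos 0
  have h3 := (ENNReal.ofReal_le_ofReal_iff (by positivity)).1 h2
  have h4 : 2 * M ≤ L * (1 + 2 * closePairsConst 0 * M) := by
    have e : ((n.totient : ℝ) * (2 * ψ n)) = 2 * M := by rw [hM]; ring
    rw [e] at h3
    nlinarith
  rw [hLv, ← ENNReal.ofReal_mul (by linarith)]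
  refine ENNReal.ofReal_le_ofReal ?_
  unfold overlapConst
  rcases le_total M 1 with h5 | h5
  · refine (min_le_right _ _).trans ?_
    nlinarith [mul_le_mul_of_nonneg_left h5 (mul_nonneg hL0 hC.le)]
  · refine (min_le_left _ _).trans ?_
    by_contra! h6
    nlinarith [mul_le_mul_of_nonneg_left h5 hL0]

theorem one_le_of_one_le_totient_mul {ψ : ℕ → ℝ} {n : ℕ} (hn : 0 < n) (hψ : 0 ≤ ψ n)
    (h : 1 ≤ n.totient * ψ n) : 1 ≤ ENNReal.ofReal overlapConst * volume (circleA ψ n) := by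
  have := min_le_volume_circleA hn hψ
  rwa [min_eq_left h, ENNReal.ofReal_one] at this

theorem volume_circleA_inter_le_mul_totient (E : ℕ) {ψ : ℕ → ℝ} {m n : ℕ} (hm : 0 < m)
    (hn : 0 < n) (hmn : m ≠ n) (hψn : 0 ≤ ψ n) (hψ : ψ n ≤ ψ m)
    (hEm : 1 ≤ 2 ^ E * (2 * ψ m * m)) (hEn : 1 ≤ 2 ^ E * (2 * ψ n * n)) :
    volume (circleA ψ m ∩ circleA ψ n) ≤ ENNReal.ofReal
      (4 * closePairsConst E * ((m.totient * ψ m) * (n.totient * ψ n))) := by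
  classical
  set T := {x ∈ reducedNumerators n ×ˢ reducedNumerators m |
    ‖circleFrac n x.1 - circleFrac m x.2‖ ≤ 2 * ψ m} with hT
  have hTc : (T.card : ℝ) ≤ closePairsConst E * (m.totient * n.totient * (2 * ψ m)) := by
    refine card_close_pairs_le E hm hn hEm (hEn.trans (by gcongr)) T fun x hx => ?_
    simp only [hT, Finset.mem_filter, Finset.mem_product] at hx
    exact ⟨hx.1.1, hx.1.2, Or.inl hmn, hx.2⟩
  refine (volume_circleA_inter_le hψ (G := T.image Prod.fst) ?_).trans ?_
  · rintro a ha ⟨b, hb, hab⟩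
    refine Finset.mem_image.2 ⟨(a, b), ?_, rfl⟩
    simp only [hT, Finset.mem_filter, Finset.mem_product]
    exact ⟨⟨ha, hb⟩, hab⟩
  · rw [← ENNReal.ofReal_natCast, ← ENNReal.ofReal_mul (by positivity)]
    refine ENNReal.ofReal_le_ofReal ?_
    calc ((T.image Prod.fst).card : ℝ) * (2 * ψ n)
        ≤ closePairsConst E * (m.totient * n.totient * (2 * ψ m)) * (2 * ψ n) := by
          gcongr
          refine le_trans ?_ hTc
          exact_mod_cast Finset.card_image_le
      _ = _ := by ring

/-- The constant in the bound for overlaps of sets of large radius. -/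
def largeRadiusConst (E : ℕ) : ℝ := overlapConst + 4 * closePairsConst E * overlapConst ^ 2

theorem volume_circleA_inter_le_of_large (E : ℕ) {ψ : ℕ → ℝ} {m n : ℕ} (hm : 0 < m)
    (hn : 0 < n) (hmn : m ≠ n) (hψm : 0 ≤ ψ m) (hψn : 0 ≤ ψ n)
    (hEm : 1 ≤ 2 ^ E * (2 * ψ m * m)) (hEn : 1 ≤ 2 ^ E * (2 * ψ n * n)) :
    volume (circleA ψ m ∩ circleA ψ n) ≤ ENNReal.ofReal (largeRadiusConst E) *
      (volume (circleA ψ m) * volume (circleA ψ n)) := by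
  have hκ := one_le_overlapConst
  have hC := closePairsConst_pos E
  have hle1 : overlapConst ≤ largeRadiusConst E := by
    unfold largeRadiusConst
    have : 0 ≤ 4 * closePairsConst E * overlapConst ^ 2 := by positivity
    linarith
  have hle2 : 4 * closePairsConst E * (overlapConst * overlapConst) ≤ largeRadiusConst E := by
    unfold largeRadiusConst
    nlinarith
  rcases le_or_gt 1 (m.totient * ψ m) with h1 | h1
  · calc volume (circleA ψ m ∩ circleA ψ n) ≤ 1 * volume (circleA ψ n) := by
          rw [one_mul]
          exact measure_mono Set.inter_subset_right
      _ ≤ (ENNReal.ofReal overlapConst * volume (circleA ψ m)) * volume (circleA ψ n) := by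
          gcongr
          exact one_le_of_one_le_totient_mul hm hψm h1
      _ ≤ _ := by
          rw [mul_assoc]
          gcongr
  rcases le_or_gt 1 (n.totient * ψ n) with h2 | h2
  · calc volume (circleA ψ m ∩ circleA ψ n) ≤ volume (circleA ψ m) * 1 := by
          rw [mul_one]
          exact measure_mono Set.inter_subset_left
      _ ≤ volume (circleA ψ m) * (ENNReal.ofReal overlapConst * volume (circleA ψ n)) := by
          gcongr
          exact one_le_of_one_le_totient_mul hn hψn h2
      _ ≤ _ := by
          rw [mul_left_comm]
          gcongr
  have h3 : volume (circleA ψ m ∩ circleA ψ n) ≤ ENNReal.ofReal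
      (4 * closePairsConst E * ((m.totient * ψ m) * (n.totient * ψ n))) := by
    rcases le_total (ψ n) (ψ m) with h | h
    · exact volume_circleA_inter_le_mul_totient E hm hn hmn hψn h hEm hEn
    · rw [Set.inter_comm, mul_comm ((m.totient : ℝ) * ψ m)]
      exact volume_circleA_inter_le_mul_totient E hn hm hmn.symm hψm h hEn hEm
  have h4 := min_le_volume_circleA hm hψm
  have h5 := min_le_volume_circleA hn hψn
  rw [min_eq_right h1.le] at h4
  rw [min_eq_right h2.le] at h5
  calc _ ≤ _ := h3
    _ = ENNReal.ofReal (4 * closePairsConst E) *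
        (ENNReal.ofReal (m.totient * ψ m) * ENNReal.ofReal (n.totient * ψ n)) := by
      rw [ENNReal.ofReal_mul (p := 4 * closePairsConst E) (by positivity),
        ENNReal.ofReal_mul (p := m.totient * ψ m) (by positivity)]
    _ ≤ ENNReal.ofReal (4 * closePairsConst E) *
        ((ENNReal.ofReal overlapConst * volume (circleA ψ m)) *
          (ENNReal.ofReal overlapConst * volume (circleA ψ n))) := by gcongr
    _ = ENNReal.ofReal (4 * closePairsConst E * (overlapConst * overlapConst)) *
        (volume (circleA ψ m) * volume (circleA ψ n)) := by
      rw [ENNReal.ofReal_mul (p := 4 * closePairsConst E) (by positivity),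
        ENNReal.ofReal_mul (p := overlapConst) (by positivity)]
      ring
    _ ≤ _ := by gcongr

/-- Quasi-independence of the sets of large radius. -/
theorem sum_sum_volume_inter_le_of_large (E : ℕ) {ψ : ℕ → ℝ} (S : Finset ℕ)
    (hS : ∀ n ∈ S, 0 < n ∧ 0 ≤ ψ n ∧ 1 ≤ 2 ^ E * (2 * ψ n * n)) :
    ∑ m ∈ S, ∑ n ∈ S, volume (circleA ψ m ∩ circleA ψ n) ≤
      ∑ n ∈ S, volume (circleA ψ n) +
        ENNReal.ofReal (largeRadiusConst E) * (∑ n ∈ S, volume (circleA ψ n)) ^ 2 := by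
  have h : ∀ m ∈ S, ∀ n ∈ S, volume (circleA ψ m ∩ circleA ψ n) ≤
      (if m = n then volume (circleA ψ n) else 0) + ENNReal.ofReal (largeRadiusConst E) *
      (volume (circleA ψ m) * volume (circleA ψ n)) := by
    intro m hm n hn
    split_ifs with hmn
    · exact (measure_mono Set.inter_subset_right).trans le_self_add
    · rw [zero_add]
      exact volume_circleA_inter_le_of_large E (hS m hm).1 (hS n hn).1 hmn (hS m hm).2.1
        (hS n hn).2.1 (hS m hm).2.2 (hS n hn).2.2
  refine (Finset.sum_le_sum fun m hm => Finset.sum_le_sum fun n hn => h m hm n hn).trans ?_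
  simp only [Finset.sum_add_distrib]
  refine add_le_add (le_of_eq ?_) (le_of_eq ?_)
  · refine Finset.sum_congr rfl fun m hm => ?_
    rw [Finset.sum_ite_eq, if_pos hm]
  · rw [sq, Finset.sum_mul_sum, Finset.mul_sum]
    simp only [Finset.mul_sum]

theorem exists_reduced_lift {m n q : ℕ} (hm : 0 < m) (hn : 0 < n) (hqm : q.Coprime m)
    (hqn : q.Coprime n) {a b : ℤ} (ha : IsCoprime a n) (hb : IsCoprime b m)
    (h : |q * (a * m - b * n)| ≤ m * n) :
    ∃ a' b' : ℤ, |a'| ≤ n ∧ |b'| ≤ m ∧ IsCoprime a' n ∧ IsCoprime b' m ∧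
      a' ≡ q * a [ZMOD n] ∧ a' * m - b' * n = q * (a * m - b * n) := by
  have hm' : (0 : ℤ) < m := by exact_mod_cast hm
  have hn' : (0 : ℤ) < n := by exact_mod_cast hn
  have hqm' : IsCoprime (q : ℤ) m := Nat.isCoprime_iff_coprime.2 hqm
  have hqn' : IsCoprime (q : ℤ) n := Nat.isCoprime_iff_coprime.2 hqn
  obtain ⟨u, hu⟩ : ∃ u : ℤ, |q * a - u * n| ≤ n ∧ |q * b - u * m| ≤ m := by
    have e := Int.emod_add_mul_ediv (q * a) n
    have r0 := Int.emod_nonneg (q * a) hn'.ne'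
    have r1 := Int.emod_lt_of_pos (q * a) hn'
    set d := (q * a) / (n : ℤ)
    set r := (q * a) % (n : ℤ)
    rw [abs_le] at h
    rcases le_or_gt 0 (q * (a * m - b * n)) with hs | hs
    · refine ⟨d, ?_, ?_⟩
      · rw [abs_le]
        constructor <;> nlinarith
      · rw [abs_le]
        have e2 : (q * b - d * m) * n = r * m - q * (a * m - b * n) := by
          rw [show r = q * a - n * d by linarith]
          ring
        constructor
        · by_contra! hlt
          nlinarith [mul_nonneg r0 hm'.le]
        · by_contra! hlt
          nlinarith [mul_lt_mul_of_pos_right r1 hm']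
    · refine ⟨d + 1, ?_, ?_⟩
      · rw [abs_le]
        constructor <;> nlinarith
      · rw [abs_le]
        have e2 : (q * b - (d + 1) * m) * n = (r - n) * m - q * (a * m - b * n) := by
          rw [show r = q * a - n * d by linarith]
          ring
        constructor
        · by_contra! hlt
          nlinarith [mul_nonneg r0 hm'.le]
        · by_contra! hlt
          nlinarith [mul_lt_mul_of_pos_right r1 hm']
  refine ⟨q * a - u * n, q * b - u * m, hu.1, hu.2, ?_, ?_, ?_, by ring⟩
  · rw [sub_eq_add_neg, ← neg_mul]
    exact IsCoprime.add_mul_right_left (hqn'.mul_left ha) _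
  · rw [sub_eq_add_neg, ← neg_mul]
    exact IsCoprime.add_mul_right_left (hqm'.mul_left hb) _
  · exact (Int.modEq_iff_dvd.2 ⟨u, by ring⟩)

section PadicBalls

variable {p : ℕ} [Fact p.Prime]

theorem padic_norm_sub_le_max (a b : ℚ_[p]) : ‖a - b‖ ≤ max ‖a‖ ‖b‖ := by
  have := Padic.nonarchimedean a (-b)
  rwa [norm_neg, ← sub_eq_add_neg] at this

/-- The `p`-adic integers within distance `r` of a `p`-adic number. -/
def padicBall (q : ℚ_[p]) (r : ℝ) : Set ℤ_[p] := {x | ‖(x : ℚ_[p]) - q‖ ≤ r}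

theorem padicBall_coe (c : ℤ_[p]) (r : ℝ) : padicBall (c : ℚ_[p]) r = Metric.closedBall c r := by
  ext x
  rw [Metric.mem_closedBall, dist_eq_norm, PadicInt.norm_def, PadicInt.coe_sub]
  rfl

theorem measurableSet_padicBall [MeasurableSpace ℤ_[p]] [BorelSpace ℤ_[p]] (q : ℚ_[p]) (r : ℝ) :
    MeasurableSet (padicBall q r) := by
  have : Continuous fun x : ℤ_[p] => ‖(x : ℚ_[p]) - q‖ := by fun_prop
  exact (isClosed_le this continuous_const).measurableSet

theorem padic_closedBall_eq_preimage (c : ℤ_[p]) (r : ℝ) :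
    Metric.closedBall c r = (fun x => x + -c) ⁻¹' Metric.closedBall 0 r := by
  ext x
  simp [dist_eq_norm, sub_eq_add_neg]

theorem measure_padic_closedBall [MeasurableSpace ℤ_[p]] [BorelSpace ℤ_[p]]
    (μ : Measure ℤ_[p]) [μ.IsAddHaarMeasure] [IsProbabilityMeasure μ] (c : ℤ_[p]) (k : ℕ) :
    μ (Metric.closedBall c ((p : ℝ) ^ (-k : ℤ))) = ENNReal.ofReal ((p : ℝ) ^ (-k : ℤ)) := by
  have hp : (0 : ℝ) < p := by exact_mod_cast (Fact.out : p.Prime).pos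
  set r : ℝ := (p : ℝ) ^ (-k : ℤ) with hr
  have htrans : ∀ c : ℤ_[p], μ (Metric.closedBall c r) = μ (Metric.closedBall 0 r) := fun c => by
    rw [padic_closedBall_eq_preimage, measure_preimage_add_right]
  have hcover : ⋃ i ∈ Finset.range (p ^ k), Metric.closedBall (i : ℤ_[p]) r = Set.univ := by
    refine Set.eq_univ_iff_forall.2 fun x => ?_
    simp only [Set.mem_iUnion, exists_prop, Finset.mem_range]
    refine ⟨x.appr k, x.appr_lt k, ?_⟩
    rw [Metric.mem_closedBall, dist_eq_norm, PadicInt.norm_le_pow_iff_mem_span_pow]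
    exact PadicInt.appr_spec k x
  have hdisj : (Finset.range (p ^ k) : Set ℕ).PairwiseDisjoint
      fun i => Metric.closedBall (i : ℤ_[p]) r := by
    intro i hi j hj hij
    refine Set.disjoint_left.2 fun x hxi hxj => hij ?_
    rw [Metric.mem_closedBall, dist_eq_norm, PadicInt.norm_le_pow_iff_mem_span_pow] at hxi hxj
    have h1 := Ideal.sub_mem _ hxj hxi
    rw [← PadicInt.norm_le_pow_iff_mem_span_pow,
      show x - (j : ℤ_[p]) - (x - i) = (((i : ℤ) - j : ℤ) : ℤ_[p]) by push_cast; ring,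
      PadicInt.norm_int_le_pow_iff_dvd] at h1
    simp only [Finset.coe_range, Set.mem_Iio] at hi hj
    have h2 : (i : ℤ) - j = 0 := by
      refine Int.eq_zero_of_abs_lt_dvd h1 ?_
      rw [abs_lt]
      have : (i : ℤ) < (p : ℤ) ^ k := by exact_mod_cast hi
      have : (j : ℤ) < (p : ℤ) ^ k := by exact_mod_cast hj
      constructor <;> omega
    omega
  have hsum := measure_biUnion_finset (μ := μ) hdisj
    fun i _ => Metric.isClosed_closedBall.measurableSet
  rw [hcover, measure_univ] at hsum
  simp only [htrans, Finset.sum_const, Finset.card_range, nsmul_eq_mul] at hsum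
  have hr' : ENNReal.ofReal r = ((p : ENNReal) ^ k)⁻¹ := by
    rw [hr, zpow_neg, zpow_natCast, ENNReal.ofReal_inv_of_pos (by positivity),
      ENNReal.ofReal_pow hp.le, ENNReal.ofReal_natCast]
  rw [htrans, hr']
  push_cast at hsum
  rw [mul_comm] at hsum
  exact ENNReal.eq_inv_of_mul_eq_one_left hsum.symm

theorem exists_zpow_neg_le_lt {r : ℝ} (h0 : 0 < r) (h1 : r < 1) :
    ∃ k : ℕ, (p : ℝ) ^ (-k : ℤ) ≤ r ∧ r < p * (p : ℝ) ^ (-k : ℤ) := by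
  have hp : (1 : ℝ) < p := by exact_mod_cast (Fact.out : p.Prime).one_lt
  obtain ⟨k, hk, hk'⟩ := exists_mem_Ico_zpow h0 hp
  have hk0 : k < 0 := by
    by_contra! h
    have := one_le_zpow₀ hp.le h
    linarith
  refine ⟨k.natAbs, ?_, ?_⟩
  · rwa [show -(k.natAbs : ℤ) = k by omega]
  · rw [show -(k.natAbs : ℤ) = k by omega, ← zpow_one_add₀ (by linarith), add_comm]
    exact hk'

theorem measure_padicBall_le [MeasurableSpace ℤ_[p]] [BorelSpace ℤ_[p]]
    (μ : Measure ℤ_[p]) [μ.IsAddHaarMeasure] [IsProbabilityMeasure μ] (q : ℚ_[p]) {r : ℝ}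
    (hr : 0 ≤ r) : μ (padicBall q r) ≤ ENNReal.ofReal r := by
  have hp : (1 : ℝ) < p := by exact_mod_cast (Fact.out : p.Prime).one_lt
  have key : ∀ r : ℝ, 0 < r → μ (padicBall q r) ≤ ENNReal.ofReal r := by
    intro r hr
    rcases le_or_gt 1 r with h1 | h1
    · exact prob_le_one.trans (ENNReal.one_le_ofReal.2 h1)
    obtain ⟨k, hk, hk'⟩ := exists_zpow_neg_le_lt (p := p) hr h1
    rcases (padicBall q r).eq_empty_or_nonempty with he | ⟨c, hc⟩
    · simp [he]
    have hsub : padicBall q r ⊆ Metric.closedBall c ((p : ℝ) ^ (-k : ℤ)) := by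
      intro x hx
      rw [Metric.mem_closedBall, dist_eq_norm, PadicInt.norm_le_pow_iff_norm_lt_pow_add_one,
        zpow_add_one₀ (by linarith), mul_comm]
      refine lt_of_le_of_lt ?_ hk'
      rw [PadicInt.norm_def, PadicInt.coe_sub,
        show (x : ℚ_[p]) - c = (x - q) - (c - q) by ring]
      exact (padic_norm_sub_le_max _ _).trans (max_le hx hc)
    calc μ (padicBall q r) ≤ _ := measure_mono hsub
      _ = _ := measure_padic_closedBall μ c k
      _ ≤ _ := ENNReal.ofReal_le_ofReal hk
  rcases hr.eq_or_lt with rfl | hr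
  · refine ENNReal.le_of_forall_pos_le_add fun ε hε _ => ?_
    rw [ENNReal.ofReal_zero, zero_add]
    have hε' : (0 : ℝ) < ε := hε
    calc μ (padicBall q 0) ≤ μ (padicBall q ε) :=
          measure_mono fun x hx => le_trans hx hε'.le
      _ ≤ _ := key _ hε'
      _ = ε := ENNReal.ofReal_coe_nnreal
  · exact key r hr

/-- The numerators `a` with `|a| ≤ n` of the reduced fractions with denominator `n`. -/
def signedNumerators (n : ℕ) : Finset ℤ := {a ∈ Finset.Icc (-(n : ℤ)) n | Int.gcd a n = 1}

theorem card_signedNumerators_le {n : ℕ} (hn : 0 < n) :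
    (signedNumerators n).card ≤ 3 * n.totient := by
  classical
  have hsub : signedNumerators n ⊆ (reducedNumerators n).image (fun a : ℕ => (a : ℤ)) ∪
      (reducedNumerators n).image (fun a : ℕ => -(a : ℤ)) ∪ {0} := by
    intro a ha
    rw [signedNumerators, Finset.mem_filter, Finset.mem_Icc] at ha
    have hcop : a.natAbs.Coprime n := by simpa [Int.gcd] using ha.2
    rcases eq_or_ne a 0 with h0 | h0
    · simp [h0]
    have hmem : a.natAbs ∈ reducedNumerators n := by
      rw [mem_reducedNumerators]
      exact ⟨by omega, by omega, hcop⟩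
    rw [Finset.mem_union, Finset.mem_union, Finset.mem_image, Finset.mem_image]
    rcases h0.lt_or_gt with h | h
    · exact Or.inl (Or.inr ⟨_, hmem, by omega⟩)
    · exact Or.inl (Or.inl ⟨_, hmem, by omega⟩)
  have h1 := Finset.card_le_card hsub
  have h2 := Finset.card_union_le ((reducedNumerators n).image (fun a : ℕ => (a : ℤ)) ∪
      (reducedNumerators n).image (fun a : ℕ => -(a : ℤ))) {0}
  have h3 := Finset.card_union_le ((reducedNumerators n).image (fun a : ℕ => (a : ℤ)))
      ((reducedNumerators n).image (fun a : ℕ => -(a : ℤ)))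
  have h4 : ((reducedNumerators n).image (fun a : ℕ => (a : ℤ))).card ≤ n.totient :=
    Finset.card_image_le.trans (card_reducedNumerators n).le
  have h5 : ((reducedNumerators n).image (fun a : ℕ => -(a : ℤ))).card ≤ n.totient :=
    Finset.card_image_le.trans (card_reducedNumerators n).le
  have h6 : 0 < n.totient := Nat.totient_pos.2 hn
  rw [Finset.card_singleton] at h2
  omega

theorem padicE_eq_biUnion (ψ : ℕ → ℝ) (n : ℕ) :
    padicE p ψ n = ⋃ a ∈ signedNumerators n, padicBall ((a : ℚ_[p]) / (n : ℚ_[p])) (ψ n) := by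
  ext x
  simp only [padicE, Set.mem_iUnion, signedNumerators, Finset.mem_filter, Finset.mem_Icc,
    padicBall, Set.mem_ofPred_eq, exists_prop, abs_le, and_assoc]

theorem measure_padicE_le [MeasurableSpace ℤ_[p]] [BorelSpace ℤ_[p]]
    (μ : Measure ℤ_[p]) [μ.IsAddHaarMeasure] [IsProbabilityMeasure μ] {ψ : ℕ → ℝ} {n : ℕ}
    (hn : 0 < n) (hψ : 0 ≤ ψ n) :
    μ (padicE p ψ n) ≤ 3 * n.totient * ENNReal.ofReal (ψ n) := by
  rw [padicE_eq_biUnion]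
  calc _ ≤ ∑ a ∈ signedNumerators n, μ (padicBall ((a : ℚ_[p]) / (n : ℚ_[p])) (ψ n)) :=
        measure_biUnion_finset_le _ _
    _ ≤ ∑ _a ∈ signedNumerators n, ENNReal.ofReal (ψ n) :=
        Finset.sum_le_sum fun a _ => measure_padicBall_le μ _ hψ
    _ ≤ _ := by
        rw [Finset.sum_const, nsmul_eq_mul]
        gcongr
        exact_mod_cast card_signedNumerators_le hn

theorem padicE_eq_univ {ψ : ℕ → ℝ} {n : ℕ} (hn : 0 < n) (h1 : 1 ≤ ψ n)
    (h2 : ‖(1 : ℚ_[p]) / (n : ℚ_[p])‖ ≤ ψ n) : padicE p ψ n = Set.univ := by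
  refine Set.eq_univ_iff_forall.2 fun x => ⟨1, ?_, Int.one_gcd, ?_⟩
  · rw [abs_one]
    exact_mod_cast hn
  · rw [Int.cast_one]
    exact (padic_norm_sub_le_max _ _).trans (max_le ((PadicInt.norm_le_one x).trans h1) h2)

theorem measure_padicBall_eq [MeasurableSpace ℤ_[p]] [BorelSpace ℤ_[p]]
    (μ : Measure ℤ_[p]) [μ.IsAddHaarMeasure] [IsProbabilityMeasure μ] {q : ℚ_[p]}
    (hq : ‖q‖ ≤ 1) (k : ℕ) :
    μ (padicBall q ((p : ℝ) ^ (-k : ℤ))) = ENNReal.ofReal ((p : ℝ) ^ (-k : ℤ)) := by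
  rw [show padicBall q ((p : ℝ) ^ (-k : ℤ)) = Metric.closedBall (⟨q, hq⟩ : ℤ_[p]) _ from
    padicBall_coe ⟨q, hq⟩ _]
  exact measure_padic_closedBall μ _ k

theorem disjoint_padicBall {n k : ℕ} (hpn : p.Coprime n) {a b : ℤ} (ha : |a| ≤ n) (hb : |b| ≤ n)
    (hk : 2 * n < p ^ k) (hab : a ≠ b) :
    Disjoint (padicBall ((a : ℚ_[p]) / (n : ℚ_[p])) ((p : ℝ) ^ (-k : ℤ)))
      (padicBall ((b : ℚ_[p]) / (n : ℚ_[p])) ((p : ℝ) ^ (-k : ℤ))) := by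
  refine Set.disjoint_left.2 fun x hxa hxb => hab ?_
  have h1 : ‖((a : ℚ_[p]) / n) - (b : ℚ_[p]) / n‖ ≤ (p : ℝ) ^ (-k : ℤ) := by
    rw [show ((a : ℚ_[p]) / n) - (b : ℚ_[p]) / n = (x - b / n) - (x - a / n) by ring]
    exact (padic_norm_sub_le_max _ _).trans (max_le hxb hxa)
  rw [← sub_div, norm_div, Padic.norm_natCast_eq_one_iff.2 hpn, div_one, ← Int.cast_sub,
    Padic.norm_int_le_pow_iff_dvd] at h1
  have h2 : a - b = 0 := by
    refine Int.eq_zero_of_abs_lt_dvd h1 ?_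
    have h3 : (2 * n : ℤ) < (p : ℤ) ^ k := by exact_mod_cast hk
    rw [abs_le] at ha hb
    rw [abs_lt]
    constructor <;> linarith
  linarith

/-- For small radii, an overlap in the circle is dominated by an overlap in the `p`-adic
integers. -/
theorem volume_inter_le_measure_padicE_inter [MeasurableSpace ℤ_[p]] [BorelSpace ℤ_[p]]
    (μ : Measure ℤ_[p]) [μ.IsAddHaarMeasure] [IsProbabilityMeasure μ] {ψ ψ' : ℕ → ℝ} {m n : ℕ}
    (hm : 0 < m) (hn : 0 < n) (hpm : p.Coprime m) (hpn : p.Coprime n) (hψ0 : 0 < ψ n)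
    (hψ : ψ n ≤ ψ m) (hSm : 4 * p * m * ψ m < 1) (hSn : 4 * p * n * ψ n < 1)
    (hm' : ψ' m = 2 * p * ψ m) (hn' : ψ' n = 2 * p * ψ n) :
    volume (circleA ψ m ∩ circleA ψ n) ≤ μ (padicE p ψ' m ∩ padicE p ψ' n) := by
  classical
  have hp : (1 : ℝ) < p := by exact_mod_cast (Fact.out : p.Prime).one_lt
  have hp0 : (0 : ℝ) < p := by linarith
  have hmR : (1 : ℝ) ≤ m := by exact_mod_cast hm
  have hnR : (1 : ℝ) ≤ n := by exact_mod_cast hn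
  have hψm0 : 0 < ψ m := hψ0.trans_le hψ
  obtain ⟨k, hk, hk'⟩ := exists_zpow_neg_le_lt (p := p) (r := 2 * p * ψ n) (by positivity)
    (by nlinarith [mul_pos hp0 hψ0])
  obtain ⟨j, hj, hj'⟩ := exists_zpow_neg_le_lt (p := p) (r := 2 * p * ψ m) (by positivity)
    (by nlinarith [mul_pos hp0 hψm0])
  have hk2 : 2 * ψ n < (p : ℝ) ^ (-k : ℤ) := by
    rw [mul_comm 2, mul_assoc] at hk'
    exact lt_of_mul_lt_mul_left hk' hp0.le
  have hj2 : 2 * ψ m < (p : ℝ) ^ (-j : ℤ) := by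
    rw [mul_comm 2, mul_assoc] at hj'
    exact lt_of_mul_lt_mul_left hj' hp0.le
  rw [← hn'] at hk
  rw [← hm'] at hj
  have hpk : 2 * n < p ^ k := by
    have h1 : 2 * n * (p : ℝ) ^ (-k : ℤ) < 1 := by
      calc 2 * n * (p : ℝ) ^ (-k : ℤ) ≤ 2 * n * ψ' n := by gcongr
        _ < 1 := by rw [hn']; linarith
    rw [zpow_neg, zpow_natCast, mul_inv_lt_iff₀ (by positivity), one_mul] at h1
    exact_mod_cast h1
  set G := {a ∈ reducedNumerators n | ∃ b ∈ reducedNumerators m,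
    ‖circleFrac n a - circleFrac m b‖ ≤ 2 * ψ m} with hG
  have hlift : ∀ a : ℕ, ∃ a' b' : ℤ, a ∈ G → |a'| ≤ n ∧ |b'| ≤ m ∧ IsCoprime a' n ∧
      IsCoprime b' m ∧ a' ≡ (p ^ j : ℕ) * a [ZMOD n] ∧ ((p ^ j : ℕ) : ℤ) ∣ a' * m - b' * n := by
    intro a
    by_cases ha : a ∈ G
    swap
    · exact ⟨0, 0, fun h => absurd h ha⟩
    obtain ⟨ha1, b, hb, hab⟩ := Finset.mem_filter.1 ha
    obtain ⟨z, hz⟩ := exists_int_of_norm_circleFrac_le hm hn hab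
    have hle : |((p ^ j : ℕ) : ℤ) * (a * m - (b + z * m) * n)| ≤ m * n := by
      have h1 : ((p ^ j : ℕ) : ℝ) * |((a * m - (b + z * m) * n : ℤ) : ℝ)| ≤ m * n := by
        have h2 : ((p ^ j : ℕ) : ℝ) * (p : ℝ) ^ (-j : ℤ) = 1 := by
          rw [zpow_neg, zpow_natCast, Nat.cast_pow]
          exact mul_inv_cancel₀ (by positivity)
        calc ((p ^ j : ℕ) : ℝ) * |((a * m - (b + z * m) * n : ℤ) : ℝ)|
            ≤ ((p ^ j : ℕ) : ℝ) * (m * n * (p : ℝ) ^ (-j : ℤ)) := by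
              gcongr
              exact hz.trans (by gcongr)
          _ = m * n * (((p ^ j : ℕ) : ℝ) * (p : ℝ) ^ (-j : ℤ)) := by ring
          _ = m * n := by rw [h2, mul_one]
      rw [abs_mul, Nat.abs_cast]
      exact_mod_cast h1
    obtain ⟨a', b', h1, h2, h3, h4, h5, h6⟩ := exists_reduced_lift (q := p ^ j) hm hn
      (hpm.pow_left j) (hpn.pow_left j)
      (Nat.isCoprime_iff_coprime.2 (mem_reducedNumerators.1 ha1).2.2)
      (IsCoprime.add_mul_right_left (Nat.isCoprime_iff_coprime.2 (mem_reducedNumerators.1 hb).2.2)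
        z) hle
    exact ⟨a', b', fun _ => ⟨h1, h2, h3, h4, h5, h6 ▸ Dvd.intro _ rfl⟩⟩
  choose f g hfg using hlift
  have hnorm_n : ‖(n : ℚ_[p])‖ = 1 := Padic.norm_natCast_eq_one_iff.2 hpn
  have hnorm_m : ‖(m : ℚ_[p])‖ = 1 := Padic.norm_natCast_eq_one_iff.2 hpm
  have hn0 : (n : ℚ_[p]) ≠ 0 := norm_ne_zero_iff.1 (by rw [hnorm_n]; exact one_ne_zero)
  have hm0 : (m : ℚ_[p]) ≠ 0 := norm_ne_zero_iff.1 (by rw [hnorm_m]; exact one_ne_zero)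
  set B : ℕ → Set ℤ_[p] := fun a =>
    padicBall ((f a : ℚ_[p]) / (n : ℚ_[p])) ((p : ℝ) ^ (-k : ℤ)) with hB
  have hinj : ∀ a ∈ G, ∀ b ∈ G, f a = f b → a = b := by
    intro a ha b hb hab
    have h1 := (hfg a ha).2.2.2.2.1
    rw [hab] at h1
    have h2 := h1.symm.trans (hfg b hb).2.2.2.2.1
    have h3 : (n : ℤ) ∣ ((p ^ j : ℕ) : ℤ) * (b - a) := by
      rw [mul_sub]
      exact h2.dvd
    have h4 : (n : ℤ) ∣ b - a :=
      (Nat.isCoprime_iff_coprime.2 (hpn.pow_left j).symm).dvd_of_dvd_mul_left h3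
    have ha1 := mem_reducedNumerators.1 (Finset.mem_filter.1 ha).1
    have hb1 := mem_reducedNumerators.1 (Finset.mem_filter.1 hb).1
    have h5 : (b : ℤ) - a = 0 := by
      refine Int.eq_zero_of_abs_lt_dvd h4 ?_
      rw [abs_lt]
      omega
    omega
  have hdisj : (G : Set ℕ).PairwiseDisjoint B := by
    intro a ha b hb hab
    exact disjoint_padicBall hpn (hfg a ha).1 (hfg b hb).1 hpk fun h => hab (hinj a ha b hb h)
  have hsub : ⋃ a ∈ G, B a ⊆ padicE p ψ' m ∩ padicE p ψ' n := by
    refine Set.iUnion₂_subset fun a ha x hx => ?_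
    obtain ⟨h1, h2, h3, h4, -, h6⟩ := hfg a ha
    have hx' : ‖(x : ℚ_[p]) - (f a : ℚ_[p]) / (n : ℚ_[p])‖ ≤ (p : ℝ) ^ (-k : ℤ) := hx
    refine ⟨⟨g a, h2, Int.isCoprime_iff_gcd_eq_one.1 h4, ?_⟩,
      ⟨f a, h1, Int.isCoprime_iff_gcd_eq_one.1 h3, hx'.trans hk⟩⟩
    have h7 : ‖(f a : ℚ_[p]) / n - (g a : ℚ_[p]) / m‖ ≤ (p : ℝ) ^ (-j : ℤ) := by
      have h8 : (f a : ℚ_[p]) / n - (g a : ℚ_[p]) / m =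
          ((f a * m - g a * n : ℤ) : ℚ_[p]) / (n * m) := by
        push_cast
        field_simp
      rw [h8, norm_div, norm_mul, hnorm_n, hnorm_m, mul_one, div_one,
        Padic.norm_int_le_pow_iff_dvd]
      exact_mod_cast h6
    rw [show (x : ℚ_[p]) - (g a : ℚ_[p]) / (m : ℚ_[p]) =
      (x - (f a : ℚ_[p]) / n) + ((f a : ℚ_[p]) / n - (g a : ℚ_[p]) / m) by ring]
    refine (Padic.nonarchimedean _ _).trans (max_le ?_ (h7.trans hj))
    refine (hx'.trans hk).trans ?_
    rw [hn', hm']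
    gcongr
  have hmeas : ∀ a ∈ G, μ (B a) = ENNReal.ofReal ((p : ℝ) ^ (-k : ℤ)) := fun a _ => by
    refine measure_padicBall_eq μ ?_ k
    rw [norm_div, hnorm_n, div_one]
    exact Padic.norm_int_le_one _
  calc volume (circleA ψ m ∩ circleA ψ n) ≤ G.card * ENNReal.ofReal (2 * ψ n) :=
        volume_circleA_inter_le hψ fun a ha h => Finset.mem_filter.2 ⟨ha, h⟩
    _ ≤ G.card * ENNReal.ofReal ((p : ℝ) ^ (-k : ℤ)) := by gcongr
    _ = ∑ a ∈ G, μ (B a) := by rw [Finset.sum_congr rfl hmeas, Finset.sum_const, nsmul_eq_mul]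
    _ = μ (⋃ a ∈ G, B a) :=
        (measure_biUnion_finset hdisj fun a _ => measurableSet_padicBall _ _).symm
    _ ≤ _ := measure_mono hsub

end PadicBalls

theorem volume_circleA_eq_zero {ψ : ℕ → ℝ} {n : ℕ} (h : ψ n = 0) : volume (circleA ψ n) = 0 := by
  have := volume_circleA_inter_le (ψ := ψ) (le_refl (ψ n)) (G := reducedNumerators n)
    fun a ha _ => ha
  rwa [Set.inter_self, h, mul_zero, ENNReal.ofReal_zero, mul_zero, nonpos_iff_eq_zero] at this

theorem circleA_zero (ψ : ℕ → ℝ) : circleA ψ 0 = ∅ := by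
  simp [circleA_eq_biUnion, reducedNumerators]

/-- A sparse infinite set of multiples of `p`, counted by a given divergent series. -/
theorem exists_sparse_multiples {p : ℕ} (hp : 0 < p) {F : ℕ → ENNReal} (hmono : Monotone F)
    (htop : Tendsto F atTop (nhds ⊤)) :
    ∃ t : ℕ → ℕ, StrictMono t ∧ (∀ k, p ∣ t k ∧ 0 < t k) ∧
      ∀ N, ∑ n ∈ Finset.Icc 1 N, (Set.range t).indicator (1 : ℕ → ENNReal) n ≤ F N := by
  classical
  have hfreq : ∀ k : ℕ, ∃ᶠ N in atTop, ((k + 1 : ℕ) : ENNReal) < F N ∧ p ∣ N ∧ 0 < N := by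
    intro k
    have h1 : ∀ᶠ N in atTop, ((k + 1 : ℕ) : ENNReal) < F N :=
      htop.eventually (lt_mem_nhds (ENNReal.natCast_lt_top _))
    have h2 : ∃ᶠ N in atTop, p ∣ N ∧ 0 < N := by
      rw [frequently_atTop]
      intro a
      exact ⟨p * (a + 1), by nlinarith, dvd_mul_right _ _, by positivity⟩
    exact (h2.and_eventually h1).mono fun N h => ⟨h.2, h.1⟩
  obtain ⟨t, ht, htP⟩ := extraction_forall_of_frequently hfreq
  refine ⟨t, ht, fun k => (htP k).2, fun N => ?_⟩
  rw [Finset.sum_indicator_eq_sum_filter]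
  simp only [Pi.one_apply, Finset.sum_const, nsmul_eq_mul, mul_one]
  set S := {n ∈ Finset.Icc 1 N | n ∈ Set.range t} with hS
  rcases S.eq_empty_or_nonempty with h | h
  · simp [h]
  · obtain ⟨hmem, k, hk⟩ := Finset.mem_filter.1 (S.max'_mem h)
    have hsub : S ⊆ (Finset.range (k + 1)).image t := by
      intro n hn
      obtain ⟨-, l, rfl⟩ := Finset.mem_filter.1 hn
      refine Finset.mem_image_of_mem _ (Finset.mem_range.2 ?_)
      have := S.le_max' _ hn
      rw [← hk, ht.le_iff_le] at this
      omega
    have hcard : S.card ≤ k + 1 :=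
      (Finset.card_le_card hsub).trans (Finset.card_image_le.trans (Finset.card_range _).le)
    have hkN : t k ≤ N := hk ▸ (Finset.mem_Icc.1 hmem).2
    calc (S.card : ENNReal) ≤ ((k + 1 : ℕ) : ENNReal) := by exact_mod_cast hcard
      _ ≤ F (t k) := (htP k).1.le
      _ ≤ F N := hmono hkN

theorem tendsto_sum_Icc_top {f : ℕ → ENNReal} (h0 : f 0 = 0) (h : ∑' n, f n = ⊤) :
    Tendsto (fun N => ∑ n ∈ Finset.Icc 1 N, f n) atTop (nhds ⊤) := by
  have h1 := (tendsto_add_atTop_iff_nat 1).2 (ENNReal.tendsto_nat_tsum f)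
  rw [h] at h1
  refine h1.congr fun N => ?_
  rw [Finset.sum_range_succ', h0, add_zero, Finset.range_eq_Ico, Finset.sum_Ico_add' f 0 N 1]
  rfl

theorem limsup_sq_div_pos {F V : ℕ → ENNReal} {C : ENNReal} (hC : C ≠ ⊤)
    (h : ∃ᶠ N in atTop, F N ≠ 0 ∧ F N ≠ ⊤ ∧ V N ≤ C * F N ^ 2) :
    0 < atTop.limsup fun N => F N ^ 2 / V N := by
  have hpos : 0 < (C + 1)⁻¹ := ENNReal.inv_pos.2 (ENNReal.add_ne_top.2 ⟨hC, ENNReal.one_ne_top⟩)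
  refine hpos.trans_le (le_limsup_of_frequently_le (h.mono fun N hN => ?_))
  obtain ⟨h0, ht, hV⟩ := hN
  rw [ENNReal.le_div_iff_mul_le (Or.inr (pow_ne_zero 2 h0)) (Or.inr (ENNReal.pow_ne_top ht)),
    mul_comm, ← div_eq_mul_inv]
  refine ENNReal.div_le_of_le_mul' (hV.trans ?_)
  gcongr
  exact le_self_add

/-- **Lemma 5 (Haynes).** Fix a prime `p`.  If `(QIA_p)` holds, then `(QIA_∞, ψ)`
holds for every non-negative `ψ` with `Σ λ(A_n(ψ)) = ∞` and `ψ(n) = 0` whenever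
`p ∣ n`. -/
theorem stmt16 (p : ℕ) [Fact p.Prime] [MeasurableSpace ℤ_[p]] [BorelSpace ℤ_[p]]
    (μ : Measure ℤ_[p]) [μ.IsAddHaarMeasure] [IsProbabilityMeasure μ]
    (hQIA : QIApHolds p μ)
    (ψ : ℕ → ℝ) (hψ : ∀ n, 0 ≤ ψ n)
    (hdiv : ∑' n : ℕ, volume (circleA ψ n) = ⊤)
    (hp0 : ∀ n : ℕ, p ∣ n → ψ n = 0) :
    QIAinftyFor ψ := by
  classical
  have hprime : p.Prime := Fact.out
  have hp1 : (1 : ℝ) ≤ p := by exact_mod_cast hprime.one_le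
  have hκ := one_le_overlapConst
  set F : ℕ → ENNReal := fun N => ∑ n ∈ Finset.Icc 1 N, volume (circleA ψ n) with hF
  have hFtop : Tendsto F atTop (nhds ⊤) :=
    tendsto_sum_Icc_top (by rw [circleA_zero, measure_empty]) hdiv
  have hFmono : Monotone F := fun M N hMN =>
    Finset.sum_le_sum_of_subset (Finset.Icc_subset_Icc_right hMN)
  have hFfin : ∀ N, F N ≠ ⊤ := fun N => ENNReal.sum_ne_top.2 fun n _ => measure_ne_top _ _
  obtain ⟨t, ht, htp, htF⟩ := exists_sparse_multiples hprime.pos hFmono hFtop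
  set Q : ℕ → Prop := fun n => 4 * p * n * ψ n < 1 with hQ
  set ψ' : ℕ → ℝ := fun n => if n ∈ Set.range t then 1 + ‖(1 : ℚ_[p]) / (n : ℚ_[p])‖ else
    if Q n then 2 * p * ψ n else 0 with hψ'
  have hψ'0 : ∀ n, 0 ≤ ψ' n := by
    intro n
    have := hψ n
    simp only [hψ']
    split_ifs <;> positivity
  have hψ'Q : ∀ n, 0 < ψ n → Q n → ψ' n = 2 * p * ψ n := by
    intro n hn hQn
    have hnt : n ∉ Set.range t := by
      rintro ⟨k, rfl⟩
      exact hn.ne' (hp0 _ (htp k).1)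
    simp only [hψ', if_neg hnt, if_pos hQn]
  have hcop : ∀ n, 0 < ψ n → p.Coprime n := fun n hn =>
    (Nat.Prime.coprime_iff_not_dvd hprime).2 fun h => hn.ne' (hp0 n h)
  have hdiv' : ∑' n : ℕ, μ (padicE p ψ' n) = ⊤ := by
    have h1 : ∀ k, μ (padicE p ψ' (t k)) = 1 := by
      intro k
      have h2 : ψ' (t k) = 1 + ‖(1 : ℚ_[p]) / (t k : ℚ_[p])‖ := if_pos ⟨k, rfl⟩
      rw [padicE_eq_univ (htp k).2 (by rw [h2]; linarith [norm_nonneg ((1 : ℚ_[p]) / t k)])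
        (by rw [h2]; linarith), measure_univ]
    rw [eq_top_iff]
    calc ⊤ = ∑' k : ℕ, μ (padicE p ψ' (t k)) := by
          simp only [h1]
          exact (ENNReal.tsum_const_eq_top_of_ne_zero one_ne_zero).symm
      _ ≤ _ := ENNReal.tsum_comp_le_tsum_of_injective ht.injective _
  set c : ENNReal := ENNReal.ofReal (6 * p) * ENNReal.ofReal overlapConst with hc
  have hFp : ∀ N, ∑ n ∈ Finset.Icc 1 N, μ (padicE p ψ' n) ≤ (c + 1) * F N := by
    intro N
    rw [add_mul, one_mul]
    refine le_trans ?_ (add_le_add_right (htF N) _)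
    rw [hF, Finset.mul_sum, ← Finset.sum_add_distrib]
    refine Finset.sum_le_sum fun n hn => ?_
    have hn0 : 0 < n := (Finset.mem_Icc.1 hn).1
    by_cases hnt : n ∈ Set.range t
    · rw [Set.indicator_of_mem hnt]
      exact prob_le_one.trans le_add_self
    refine le_trans ?_ le_self_add
    refine (measure_padicE_le μ hn0 (hψ'0 n)).trans ?_
    by_cases hQn : Q n
    · have h1 : ψ' n = 2 * p * ψ n := by simp only [hψ', if_neg hnt, if_pos hQn]
      have hφ : (n.totient : ℝ) ≤ n := by exact_mod_cast Nat.totient_le n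
      have h2 : n.totient * ψ n ≤ 1 := by
        have h3 : 0 ≤ n * ψ n := mul_nonneg (Nat.cast_nonneg n) (hψ n)
        have h4 : 4 * p * n * ψ n < 1 := hQn
        have h5 : n.totient * ψ n ≤ n * ψ n := mul_le_mul_of_nonneg_right hφ (hψ n)
        nlinarith
      have h3 := min_le_volume_circleA hn0 (hψ n)
      rw [min_eq_right h2] at h3
      calc 3 * (n.totient : ENNReal) * ENNReal.ofReal (ψ' n)
          = ENNReal.ofReal (6 * p) * ENNReal.ofReal (n.totient * ψ n) := by
            rw [← ENNReal.ofReal_mul (by positivity), h1,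
              show (3 * n.totient : ENNReal) = ENNReal.ofReal (3 * n.totient) by
                rw [ENNReal.ofReal_mul (by positivity), ENNReal.ofReal_natCast]
                norm_num,
              ← ENNReal.ofReal_mul (by positivity)]
            congr 1
            ring
        _ ≤ _ := by
            rw [hc, mul_assoc]
            gcongr
    · have h1 : ψ' n = 0 := by simp only [hψ', if_neg hnt, if_neg hQn]
      simp [h1]
  have hV1 : ∀ N, ∑ m ∈ Finset.Icc 1 N with Q m, ∑ n ∈ Finset.Icc 1 N with Q n,
      volume (circleA ψ m ∩ circleA ψ n) ≤
      ∑ m ∈ Finset.Icc 1 N, ∑ n ∈ Finset.Icc 1 N, μ (padicE p ψ' m ∩ padicE p ψ' n) := by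
    intro N
    refine (Finset.sum_le_sum fun m hm => ?_).trans
      (Finset.sum_le_sum_of_subset (Finset.filter_subset _ _))
    refine (Finset.sum_le_sum fun n hn => ?_).trans
      (Finset.sum_le_sum_of_subset (Finset.filter_subset _ _))
    obtain ⟨hm, hQm⟩ := Finset.mem_filter.1 hm
    obtain ⟨hn, hQn⟩ := Finset.mem_filter.1 hn
    have hm0 : 0 < m := (Finset.mem_Icc.1 hm).1
    have hn0 : 0 < n := (Finset.mem_Icc.1 hn).1
    rcases (hψ m).eq_or_lt with h1 | h1
    · rw [measure_mono_null Set.inter_subset_left (volume_circleA_eq_zero h1.symm)]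
      exact zero_le
    rcases (hψ n).eq_or_lt with h2 | h2
    · rw [measure_mono_null Set.inter_subset_right (volume_circleA_eq_zero h2.symm)]
      exact zero_le
    rcases le_total (ψ n) (ψ m) with h | h
    · exact volume_inter_le_measure_padicE_inter μ hm0 hn0 (hcop m h1) (hcop n h2) h2 h hQm hQn
        (hψ'Q m h1 hQm) (hψ'Q n h2 hQn)
    · rw [Set.inter_comm, Set.inter_comm (padicE p ψ' m)]
      exact volume_inter_le_measure_padicE_inter μ hn0 hm0 (hcop n h2) (hcop m h1) h1 h hQn hQm
        (hψ'Q n h2 hQn) (hψ'Q m h1 hQm)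
  set K := ENNReal.ofReal (largeRadiusConst (2 * p)) with hK
  have hV2 : ∀ N, ∑ m ∈ Finset.Icc 1 N with ¬ Q m, ∑ n ∈ Finset.Icc 1 N with ¬ Q n,
      volume (circleA ψ m ∩ circleA ψ n) ≤ F N + K * F N ^ 2 := by
    intro N
    have hle : ∑ n ∈ Finset.Icc 1 N with ¬ Q n, volume (circleA ψ n) ≤ F N :=
      Finset.sum_le_sum_of_subset (Finset.filter_subset _ _)
    refine (sum_sum_volume_inter_le_of_large (2 * p) _ fun n hn => ?_).trans
      (add_le_add hle (by gcongr))
    obtain ⟨hn, hQn⟩ := Finset.mem_filter.1 hn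
    refine ⟨(Finset.mem_Icc.1 hn).1, hψ n, (not_lt.1 hQn).trans ?_⟩
    have h1 : (2 * p : ℝ) ≤ 2 ^ (2 * p) := by exact_mod_cast (Nat.lt_two_pow_self (n := 2 * p)).le
    calc 4 * p * n * ψ n = 2 * p * (2 * ψ n * n) := by ring
      _ ≤ _ := by
        have := hψ n
        gcongr
  obtain ⟨δ, hδ0, hδ⟩ := exists_between (hQIA ψ' hψ'0 hdiv')
  have hfreq := frequently_lt_of_lt_limsup (by isBoundedDefault) hδ
  have hone : ∀ᶠ N in atTop, 1 < F N := hFtop.eventually (lt_mem_nhds ENNReal.one_lt_top)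
  refine limsup_sq_div_pos (F := F) (C := 2 * ((c + 1) ^ 2 / δ) + 2 * (1 + K)) ?_
    ((hfreq.and_eventually hone).mono fun N hN => ⟨?_, hFfin N, ?_⟩)
  · have hctop : c + 1 ≠ ⊤ := ENNReal.add_ne_top.2
      ⟨ENNReal.mul_ne_top ENNReal.ofReal_ne_top ENNReal.ofReal_ne_top, ENNReal.one_ne_top⟩
    refine ENNReal.add_ne_top.2 ⟨ENNReal.mul_ne_top ENNReal.ofNat_ne_top
      (ENNReal.div_ne_top (ENNReal.pow_ne_top hctop) hδ0.ne'), ENNReal.mul_ne_top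
      ENNReal.ofNat_ne_top (ENNReal.add_ne_top.2 ⟨ENNReal.one_ne_top, ENNReal.ofReal_ne_top⟩)⟩
  · exact (zero_lt_one.trans hN.2).ne'
  · obtain ⟨h1, h2⟩ := hN
    have hδtop : δ ≠ ⊤ := (hδ.trans_le le_top).ne
    have hVp := ENNReal.mul_le_of_le_div h1.le
    have h3 : ∑ m ∈ Finset.Icc 1 N with Q m, ∑ n ∈ Finset.Icc 1 N with Q n,
        volume (circleA ψ m ∩ circleA ψ n) ≤ (c + 1) ^ 2 / δ * F N ^ 2 := by
      rw [ENNReal.mul_comm_div, ← mul_div_assoc,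
        ENNReal.le_div_iff_mul_le (Or.inl hδ0.ne') (Or.inl hδtop), mul_comm, ← mul_pow]
      calc _ ≤ _ := mul_le_mul_right (hV1 N) δ
        _ ≤ _ := hVp
        _ ≤ _ := pow_le_pow_left' (hFp N) 2
    have h4 : F N + K * F N ^ 2 ≤ (1 + K) * F N ^ 2 := by
      rw [add_mul, one_mul]
      gcongr
      exact le_self_pow₀ h2.le two_ne_zero
    calc _ ≤ _ := sum_sum_inter_le_filter volume (Finset.Icc 1 N) Q (measurableSet_circleA ψ)
      _ ≤ 2 * ((c + 1) ^ 2 / δ * F N ^ 2) + 2 * ((1 + K) * F N ^ 2) := by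
        gcongr
        exact (hV2 N).trans h4
      _ = _ := by ring
end
end
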